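/- arXiv:math/0307080 — 4 statements merged into one kernel-verified Lean document; each statement's English description precedes it below -/
import Mathlib

section
/- Let (A, m, k) and (B, n, k') be Noetherian local rings and φ : A → B a local ring homomorphism. If dim B = dim A + dim(B/mB), A is regular, and B/mB is regular, then B is flat over A and B is regular. -/
/-- A commutative ring is a *regular local ring* if it is a Noetherian local ring whose
maximal ideal can be generated by `d` elements, where `d` is the Krull dimension. -/
def IsRegularLocal (A : Type*) [CommRing A] : Prop :=
  IsNoetherianRing A ∧
  ∃ h : IsLocalRing A, ∃ s : Finset A,
    Ideal.span (s : Set A) = @IsLocalRing.maximalIdeal A _ h ∧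
    (s.card : WithBot (WithTop ℕ)) = ringKrullDim A

section

open TensorProduct IsLocalRing

theorem TensorProduct.exists_eq_sum_tmul_of_span_range_eq_top {R M N ι : Type*} [CommRing R]
    [AddCommGroup M] [AddCommGroup N] [Module R M] [Module R N] [Fintype ι] {f : ι → N}
    (hf : Submodule.span R (Set.range f) = ⊤) (k : M ⊗[R] N) :
    ∃ b : ι → M, k = ∑ i, b i ⊗ₜ f i := by
  induction k with
  | zero => exact ⟨0, by simp⟩
  | add k₁ k₂ h₁ h₂ =>
    obtain ⟨b₁, rfl⟩ := h₁
    obtain ⟨b₂, rfl⟩ := h₂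
    exact ⟨b₁ + b₂, by simp [add_tmul, Finset.sum_add_distrib]⟩
  | tmul b c =>
    obtain ⟨a, rfl⟩ := (Submodule.mem_span_range_iff_exists_fun R).1
      (hf ▸ Submodule.mem_top : c ∈ Submodule.span R (Set.range f))
    exact ⟨fun i ↦ a i • b, by simp [tmul_sum, smul_tmul]⟩

theorem exists_lTensor_colon_eq {A B : Type*} [CommRing A] [CommRing B] [Algebra A B]
    {x : A} {I J : Ideal A} (hJ : ∀ c, x * c ∈ I → c ∈ J) (hI : I.FG)
    {μ : J →ₗ[A] I} (hμ : ∀ c, (μ c : A) = x * c)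
    (hT : Function.Injective ((I ⊔ Ideal.span {x}).subtype.lTensor B))
    {k : B ⊗[A] I} (hk : I.subtype.lTensor B k = 0) :
    ∃ t : B ⊗[A] J, J.subtype.lTensor B t = 0 ∧
      μ.lTensor B t = k := by
  have : Module.Finite A I := .of_fg hI
  obtain ⟨n, f, hf⟩ := Module.Finite.exists_fin (R := A) (M := I)
  obtain ⟨b, rfl⟩ := exists_eq_sum_tmul_of_span_range_eq_top hf k
  set I' := I ⊔ Ideal.span {x}
  let x' : I' := ⟨x, Ideal.mem_sup_right (Ideal.mem_span_singleton_self x)⟩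
  let g : Option (Fin n) → I' := fun o ↦ o.elim x' fun i ↦ Submodule.inclusion le_sup_left (f i)
  let b' : Option (Fin n) → B := fun o ↦ o.elim 0 b
  have hg : Submodule.span A (Set.range g) = ⊤ := by
    apply Submodule.map_injective_of_injective I'.subtype_injective
    rw [Submodule.map_span, Submodule.map_top, Submodule.range_subtype]
    apply le_antisymm
    · rw [Submodule.span_le]
      rintro _ ⟨y, -, rfl⟩
      exact y.2
    · refine sup_le (fun y hy ↦ ?_) ?_
      · have h1 : (⟨y, hy⟩ : I) ∈ Submodule.span A (Set.range f) := hf ▸ Submodule.mem_top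
        have h2 := Submodule.mem_map_of_mem (f := I.subtype) h1
        rw [Submodule.map_span] at h2
        refine Submodule.span_mono ?_ h2
        rintro _ ⟨_, ⟨i, rfl⟩, rfl⟩
        exact ⟨_, ⟨some i, rfl⟩, rfl⟩
      · refine Submodule.span_mono ?_
        rintro _ rfl
        exact ⟨_, ⟨none, rfl⟩, rfl⟩
  have h0 : ∑ o, g o ⊗ₜ[A] b' o = 0 := by
    apply (TensorProduct.comm A I' B).injective
    apply hT
    simp only [map_sum, map_zero] at hk ⊢
    simpa [Fintype.sum_option, g, b'] using hk
  obtain ⟨m, c, y, hb, hc⟩ := vanishesTrivially_of_sum_tmul_eq_zero A hg h0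
  have hb0 : 0 = ∑ j, c none j • y j := hb none
  have hbs (i) : b i = ∑ j, c (some i) j • y j := hb (some i)
  have hcs (j) : ∑ i, c (some i) j • f i = -(c none j * x) := by
    have := congr_arg Subtype.val (hc j)
    simp only [Fintype.sum_option] at this
    simp [g, x'] at this
    simp
    linear_combination this
  have hcJ (j) : c none j ∈ J := by
    apply hJ
    rw [mul_comm, ← neg_mem_iff, ← hcs]
    exact SetLike.coe_mem _
  refine ⟨-∑ j, y j ⊗ₜ ⟨c none j, hcJ j⟩, ?_, ?_⟩
  · apply (TensorProduct.rid A B).injective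
    simp [← hb0]
  · simp_rw [hbs, sum_tmul, smul_tmul]
    rw [Finset.sum_comm, map_neg, map_sum, ← Finset.sum_neg_distrib]
    refine Finset.sum_congr rfl fun j _ ↦ ?_
    rw [← tmul_sum, LinearMap.lTensor_tmul, ← tmul_neg]
    congr 1
    apply Subtype.ext
    rw [hcs, Submodule.coe_neg, hμ, mul_comm]

theorem lTensor_subtype_injective_of_mem {A B A' B' : Type*} [CommRing A] [CommRing B]
    [CommRing A'] [CommRing B'] [Algebra A B] [Algebra A' B'] [Module.Flat A' B']
    {x : A} (hxB : algebraMap A B x ∈ nonZeroDivisors B)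
    {π : A →+* A'} {ρ : B →+* B'} (hπ : Function.Surjective π) (hρ : Function.Surjective ρ)
    (hkπ : RingHom.ker π = Ideal.span {x}) (hkρ : RingHom.ker ρ = Ideal.span {algebraMap A B x})
    (hc : ∀ a, ρ (algebraMap A B a) = algebraMap A' B' (π a))
    {I : Ideal A} (hI : I.FG) (hx : x ∈ I) : Function.Injective (I.subtype.lTensor B) := by
  rw [injective_iff_map_eq_zero]
  intro k hk
  have : Module.Finite A I := .of_fg hI
  obtain ⟨n, f, hf⟩ := Module.Finite.exists_fin (R := A) (M := I)
  obtain ⟨b, rfl⟩ := exists_eq_sum_tmul_of_span_range_eq_top hf k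
  have h0 : ∑ i, (f i : A) • b i = 0 := by
    simpa using congr_arg (TensorProduct.rid A B) hk
  have h1 : ∑ i, π (f i) • ρ (b i) = 0 := by
    simpa [Algebra.smul_def, hc] using congr_arg ρ h0
  obtain ⟨m, c', y', hb, hc'⟩ := Module.Flat.isTrivialRelation_of_sum_smul_eq_zero (R := A') (M := B')
    (f := fun i ↦ π (f i)) (x := fun i ↦ ρ (b i)) h1
  choose c hcc using fun i j ↦ hπ (c' i j)
  choose y hy using fun j ↦ hρ (y' j)
  have hz (i) : ∃ z, b i - ∑ j, c i j • y j = z * algebraMap A B x := by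
    have : b i - ∑ j, c i j • y j ∈ RingHom.ker ρ := by
      simp [RingHom.mem_ker, hb, Algebra.smul_def, hc, hcc, hy]
    rw [hkρ, Ideal.mem_span_singleton'] at this
    exact this.imp fun _ ↦ Eq.symm
  have hd (j) : ∃ d, ∑ i, f i * c i j = d * x := by
    have : ∑ i, f i * c i j ∈ RingHom.ker π := by
      simp [RingHom.mem_ker, hcc, hc']
    rw [hkπ, Ideal.mem_span_singleton'] at this
    exact this.imp fun _ ↦ Eq.symm
  choose z hz using hz
  choose d hd using hd
  let x' : I := ⟨x, hx⟩
  obtain ⟨w, hw⟩ : ∃ w : B, ∑ i, b i ⊗ₜ[A] f i = w ⊗ₜ x' := by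
    refine ⟨∑ i, (f i : A) • z i + ∑ j, d j • y j, ?_⟩
    have hbi (i) : b i ⊗ₜ[A] f i = ((f i : A) • z i) ⊗ₜ x' + ∑ j, y j ⊗ₜ (c i j • f i) := by
      rw [eq_add_of_sub_eq (hz i), add_tmul, sum_tmul]
      congr 1
      · rw [mul_comm, ← Algebra.smul_def, smul_tmul, smul_tmul]
        congr 1
        ext
        simp [x', mul_comm]
      · simp_rw [smul_tmul]
    simp_rw [hbi, Finset.sum_add_distrib, add_tmul, sum_tmul]
    congr 1
    rw [Finset.sum_comm]
    refine Finset.sum_congr rfl fun j _ ↦ ?_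
    rw [← tmul_sum, smul_tmul]
    congr 1
    ext
    simpa [x', mul_comm] using hd j
  rw [hw] at hk ⊢
  have : w * algebraMap A B x = 0 := by
    simpa [x', Algebra.smul_def, mul_comm] using congr_arg (TensorProduct.rid A B) hk
  rw [(mul_right_mem_nonZeroDivisors_eq_zero_iff hxB).1 this, zero_tmul]

/-- If `x` is regular on `B`, lies in the Jacobson radical of `B`, and `B / xB` is flat over
`A / xA`, then `B` is flat over `A`. -/
theorem flat_of_flat_quotient_span_singleton {A B A' B' : Type*} [CommRing A] [CommRing B]
    [CommRing A'] [CommRing B'] [IsNoetherianRing A] [IsNoetherianRing B]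
    [Algebra A B] [Algebra A' B'] [Module.Flat A' B']
    {x : A} (hxB : algebraMap A B x ∈ nonZeroDivisors B)
    (hxj : algebraMap A B x ∈ (⊥ : Ideal B).jacobson)
    {π : A →+* A'} {ρ : B →+* B'} (hπ : Function.Surjective π) (hρ : Function.Surjective ρ)
    (hkπ : RingHom.ker π = Ideal.span {x}) (hkρ : RingHom.ker ρ = Ideal.span {algebraMap A B x})
    (hc : ∀ a, ρ (algebraMap A B a) = algebraMap A' B' (π a)) : Module.Flat A B := by
  rw [Module.Flat.iff_lTensor_injective']
  intro I
  induction I using IsNoetherian.induction with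
  | hgt I ih =>
  have hI : I.FG := IsNoetherian.noetherian I
  by_cases hx : x ∈ I
  · exact lTensor_subtype_injective_of_mem hxB hπ hρ hkπ hkρ hc hI hx
  have hT := ih (I ⊔ Ideal.span {x}) (by simpa [Ideal.span_le] using hx)
  let J : Ideal A := I.comap (LinearMap.lsmul A A x)
  have hIJ : I ≤ J := fun y hy ↦ Ideal.mul_mem_left I x hy
  rw [injective_iff_map_eq_zero]
  rcases hIJ.lt_or_eq with hlt | heq
  · intro k hk
    let μ : J →ₗ[A] I := (LinearMap.lsmul A A x).restrict fun _ hc ↦ hc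
    obtain ⟨t, ht, rfl⟩ := exists_lTensor_colon_eq (J := J) (fun _ ↦ id) hI (μ := μ)
      (fun _ ↦ rfl) hT hk
    rw [(injective_iff_map_eq_zero _).1 (ih J hlt) t ht, map_zero]
  · have hmem (c : A) (hc : x * c ∈ I) : c ∈ I := by
      rw [heq]
      exact hc
    have hbot : LinearMap.ker (I.subtype.baseChange B) = ⊥ := by
      have : Module.Finite A I := .of_fg hI
      refine Submodule.eq_bot_of_le_smul_of_le_jacobson_bot (Ideal.span {algebraMap A B x}) _
        (IsNoetherian.noetherian _) (fun k hk ↦ ?_) (by simpa [Ideal.span_le] using hxj)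
      obtain ⟨t, ht, rfl⟩ := exists_lTensor_colon_eq hmem hI (μ := x • LinearMap.id)
        (fun _ ↦ rfl) hT (k := k) hk
      rw [LinearMap.lTensor_smul, LinearMap.lTensor_id, LinearMap.smul_apply, LinearMap.id_apply,
        ← algebraMap_smul B x t]
      exact Submodule.smul_mem_smul (Ideal.mem_span_singleton_self _)
        (show t ∈ LinearMap.ker (I.subtype.baseChange B) from ht)
    intro k hk
    have : k ∈ LinearMap.ker (I.subtype.baseChange B) := hk
    rwa [hbot] at this

theorem ringKrullDim_le_card_of_span_range_eq {R : Type*} [CommRing R] [IsNoetherianRing R]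
    [IsLocalRing R] {ι : Type*} [Fintype ι] (s : ι → R)
    (hs : Ideal.span (Set.range s) = maximalIdeal R) : ringKrullDim R ≤ Fintype.card ι := by
  refine (ringKrullDim_le_spanFinrank_maximalIdeal R).trans ?_
  rw [← hs]
  have h1 := Submodule.spanFinrank_span_le_ncard_of_finite (R := R) (Set.finite_range s)
  have h2 : (Set.range s).ncard ≤ Fintype.card ι := by
    rw [← Nat.card_eq_fintype_card, ← Nat.card_coe_set_eq]
    exact Finite.card_range_le s
  exact_mod_cast h1.trans h2

theorem exists_notMem_sq_notMem_minimalPrimes {R : Type*} [CommRing R] [IsNoetherianRing R]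
    [IsLocalRing R] (h : 0 < ringKrullDim R) :
    ∃ x ∈ maximalIdeal R, x ∉ maximalIdeal R ^ 2 ∧ ∀ P ∈ minimalPrimes R, x ∉ P := by
  by_contra! hc
  have hfin := Ideal.finite_minimalPrimes_of_isNoetherianRing R (⊥ : Ideal R)
  classical
  obtain ⟨P, hP, hle⟩ := (Ideal.subset_union_prime (s := insert (maximalIdeal R ^ 2) hfin.toFinset)
    (f := id) (maximalIdeal R ^ 2) (maximalIdeal R ^ 2) (I := maximalIdeal R) (by
      intro P hP h1 _
      simp only [Finset.mem_insert, h1, Set.Finite.mem_toFinset, false_or] at hP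
      exact hP.1.1)).1 (by
      intro x hx
      by_cases h2 : x ∈ maximalIdeal R ^ 2
      · simp only [Set.mem_iUnion]
        exact ⟨_, by simp, h2⟩
      · obtain ⟨P, hP, hxP⟩ := hc x hx h2
        simp only [Set.mem_iUnion]
        exact ⟨P, by simpa using Or.inr hP, hxP⟩)
  rw [← maximalIdeal_height_eq_ringKrullDim] at h
  simp only [Finset.mem_insert, Set.Finite.mem_toFinset] at hP
  rcases hP with rfl | hP
  · have : maximalIdeal R = ⊥ := Submodule.eq_bot_of_le_smul_of_le_jacobson_bot _ _
      (maximalIdeal R).fg_of_isNoetherianRing (by simpa [pow_two] using hle)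
      (maximalIdeal_le_jacobson _)
    rw [maximalIdeal_height_eq_ringKrullDim] at h
    exact absurd (ringKrullDim_le_card_of_span_range_eq (R := R) (Fin.elim0 : Fin 0 → R)
      (by simp [this])) (by simpa using h)
  · have hPm : P = maximalIdeal R := le_antisymm (le_maximalIdeal hP.1.1.ne_top) hle
    subst hPm
    have := Ideal.height_eq_zero_iff.2 hP
    simp [this] at h

theorem ringKrullDim_le_quotient_span_singleton_succ {R : Type*} [CommRing R] [IsNoetherianRing R]
    [IsLocalRing R] {x : R} (hx : x ∈ maximalIdeal R) :
    ringKrullDim R ≤ ringKrullDim (R ⧸ Ideal.span {x}) + 1 := by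
  simpa using ringKrullDim_le_ringKrullDim_quotient_add_encard ({x} : Set R)
    (by simpa [IsLocalRing.ringJacobson_eq_maximalIdeal] using hx)

theorem isLocalRing_quotient {R : Type*} [CommRing R] [IsLocalRing R] {I : Ideal R}
    (hx : I ≤ maximalIdeal R) : IsLocalRing (R ⧸ I) :=
  have : Nontrivial (R ⧸ I) :=
    Ideal.Quotient.nontrivial_iff.2 (ne_top_of_le_ne_top Ideal.IsPrime.ne_top' hx)
  .of_surjective' _ Ideal.Quotient.mk_surjective

theorem map_quotientMk_maximalIdeal {R : Type*} [CommRing R] [IsLocalRing R] {I : Ideal R}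
    [IsLocalRing (R ⧸ I)] :
    (maximalIdeal R).map (Ideal.Quotient.mk I) = maximalIdeal (R ⧸ I) := by
  rw [← eq_maximalIdeal (Ideal.comap_isMaximal_of_surjective _ Ideal.Quotient.mk_surjective
    (K := maximalIdeal (R ⧸ I))), Ideal.map_comap_of_surjective _ Ideal.Quotient.mk_surjective]

theorem exists_span_insert_eq_of_notMem_sq {R : Type*} [CommRing R] [IsLocalRing R]
    {n : ℕ} (s : Fin (n + 1) → R)
    (hs : Ideal.span (Set.range s) = maximalIdeal R) {x : R} (hx : x ∈ maximalIdeal R)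
    (hx2 : x ∉ maximalIdeal R ^ 2) :
    ∃ t : Fin n → R, Ideal.span (insert x (Set.range t)) = maximalIdeal R := by
  obtain ⟨c, hc⟩ := (Ideal.mem_span_range_iff_exists_fun).1 (hs ▸ hx)
  have hsm (i) : s i ∈ maximalIdeal R := hs ▸ Ideal.subset_span ⟨i, rfl⟩
  obtain ⟨i, hi⟩ : ∃ i, IsUnit (c i) := by
    by_contra! h
    apply hx2
    rw [← hc, pow_two]
    exact Ideal.sum_mem _ fun i _ ↦ Ideal.mul_mem_mul (h i) (hsm i)
  refine ⟨fun j ↦ s (i.succAbove j), le_antisymm ?_ ?_⟩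
  · rw [Ideal.span_le]
    rintro _ (rfl | ⟨j, rfl⟩)
    exacts [hx, hsm _]
  · rw [← hs, Ideal.span_le]
    rintro _ ⟨j, rfl⟩
    have hmem (j) : s (i.succAbove j) ∈
        Ideal.span (insert x (Set.range fun j ↦ s (i.succAbove j))) :=
      Ideal.subset_span (Or.inr ⟨j, rfl⟩)
    rcases Fin.eq_self_or_eq_succAbove i j with rfl | ⟨j, rfl⟩
    · rw [SetLike.mem_coe, ← Ideal.unit_mul_mem_iff_mem _ hi]
      rw [Fin.sum_univ_succAbove _ j] at hc
      rw [← eq_sub_iff_add_eq] at hc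
      rw [hc]
      exact Ideal.sub_mem _ (Ideal.subset_span (Or.inl rfl))
        (Ideal.sum_mem _ fun l _ ↦ Ideal.mul_mem_left _ _ (hmem l))
    · exact hmem j

/-- A regular local ring is a domain. -/
theorem isDomain_of_span_range_eq (n : ℕ) : ∀ {R : Type*} [CommRing R] [IsNoetherianRing R]
    [IsLocalRing R] (s : Fin n → R) (_ : Ideal.span (Set.range s) = maximalIdeal R)
    (_ : n ≤ ringKrullDim R), IsDomain R := by
  induction n with
  | zero =>
    intro R _ _ _ s hs _
    have : maximalIdeal R = ⊥ := by simp [← hs]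
    exact (isField_iff_maximalIdeal_eq.2 this).isDomain
  | succ n ih =>
    intro R _ _ _ s hs hn
    obtain ⟨x, hx, hx2, hxP⟩ := exists_notMem_sq_notMem_minimalPrimes
      (R := R) (lt_of_lt_of_le (by exact_mod_cast n.succ_pos) hn)
    obtain ⟨t, ht⟩ := exists_span_insert_eq_of_notMem_sq s hs hx hx2
    have hle : Ideal.span {x} ≤ maximalIdeal R := by simpa [Ideal.span_le] using hx
    have := isLocalRing_quotient hle
    have hd : IsDomain (R ⧸ Ideal.span {x}) := by
      refine ih (fun i ↦ Ideal.Quotient.mk _ (t i)) ?_ ?_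
      · rw [← map_quotientMk_maximalIdeal, ← ht, Ideal.map_span, Set.image_insert_eq,
          Ideal.Quotient.eq_zero_iff_mem.2 (Ideal.mem_span_singleton_self x),
          Ideal.span_insert_zero, ← Set.range_comp]
        rfl
      · rw [← ENat.WithBot.add_le_add_one_right_iff]
        exact le_trans (by exact_mod_cast hn) (ringKrullDim_le_quotient_span_singleton_succ hx)
    have hp : (Ideal.span {x}).IsPrime := (Ideal.Quotient.isDomain_iff_prime _).1 hd
    obtain ⟨P, hP, hPx⟩ := Ideal.exists_minimalPrimes_le (bot_le (a := Ideal.span {x}))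
    have hPp : P.IsPrime := hP.1.1
    have hPbot : P = ⊥ := by
      refine Submodule.eq_bot_of_le_smul_of_le_jacobson_bot (maximalIdeal R) P
        P.fg_of_isNoetherianRing (fun y hy ↦ ?_) (maximalIdeal_le_jacobson _)
      obtain ⟨z, rfl⟩ := Ideal.mem_span_singleton'.1 (hPx hy)
      have hz : z ∈ P := (hPp.mem_or_mem hy).resolve_right (hxP P hP)
      rw [mul_comm]
      exact Ideal.mul_mem_mul hx hz
    subst hPbot
    exact IsDomain.of_bot_isPrime R

theorem isDomain_of_span_range_eq_of_fintype {R : Type*} [CommRing R] [IsNoetherianRing R]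
    [IsLocalRing R] {ι : Type*} [Fintype ι] (s : ι → R)
    (hs : Ideal.span (Set.range s) = maximalIdeal R) (hdim : Fintype.card ι ≤ ringKrullDim R) :
    IsDomain R :=
  isDomain_of_span_range_eq _ (s ∘ (Fintype.equivFin ι).symm)
    (by rwa [EquivLike.range_comp]) hdim

theorem flat_of_span_range_eq (d : ℕ) : ∀ {A B : Type*} [CommRing A] [CommRing B]
    [IsLocalRing A] [IsLocalRing B] [IsNoetherianRing A] [IsNoetherianRing B] [Algebra A B]
    {ι : Type*} [Fintype ι] (a : Fin d → A) (b : ι → B)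
    (_ : Ideal.span (Set.range a) = maximalIdeal A)
    (_ : Ideal.span (Set.range (algebraMap A B ∘ a) ∪ Set.range b) = maximalIdeal B)
    (_ : ((d + Fintype.card ι : ℕ) : WithBot ℕ∞) ≤ ringKrullDim B), Module.Flat A B := by
  induction d with
  | zero =>
    intro A B _ _ _ _ _ _ _ ι _ a b ha _ _
    have : maximalIdeal A = ⊥ := by simp [← ha]
    let := (isField_iff_maximalIdeal_eq.2 this).toField
    infer_instance
  | succ d ih =>
    intro A B _ _ _ _ _ _ _ ι _ a b ha hb hdim
    set x := a 0
    set y := algebraMap A B x with hy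
    have hxm : x ∈ maximalIdeal A := ha ▸ Ideal.subset_span ⟨0, rfl⟩
    have hym : y ∈ maximalIdeal B := hb ▸ Ideal.subset_span (Or.inl ⟨0, rfl⟩)
    have : IsDomain B := by
      refine isDomain_of_span_range_eq_of_fintype (Sum.elim (algebraMap A B ∘ a) b) ?_ ?_
      · rwa [Set.Sum.elim_range]
      · simpa using hdim
    have hra : Set.range a = insert x (Set.range (Fin.tail a)) := by
      conv_lhs => rw [← Fin.cons_self_tail a, Fin.range_cons]
    rw [Set.range_comp, hra, Set.image_insert_eq, ← Set.range_comp, Set.insert_union, ← hy] at hb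
    have hy0 : y ≠ 0 := by
      intro h0
      rw [h0, Ideal.span_insert_zero, ← Set.Sum.elim_range] at hb
      have h := hdim.trans (ringKrullDim_le_card_of_span_range_eq _ hb)
      rw [Fintype.card_sum, Fintype.card_fin] at h
      have h' : d + 1 + Fintype.card ι ≤ d + Fintype.card ι := by exact_mod_cast h
      omega
    have hleA : Ideal.span {x} ≤ maximalIdeal A := by simpa [Ideal.span_le] using hxm
    have hleB : Ideal.span {y} ≤ maximalIdeal B := by simpa [Ideal.span_le] using hym
    have := isLocalRing_quotient hleA
    have := isLocalRing_quotient hleB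
    let φ : A ⧸ Ideal.span {x} →+* B ⧸ Ideal.span {y} :=
      Ideal.quotientMap (Ideal.span {y}) (algebraMap A B)
        (by rw [Ideal.span_singleton_le_iff_mem]; exact Ideal.mem_span_singleton_self y)
    let := φ.toAlgebra
    have hflat : Module.Flat (A ⧸ Ideal.span {x}) (B ⧸ Ideal.span {y}) := by
      refine ih (fun i ↦ Ideal.Quotient.mk _ (a i.succ)) (fun i ↦ Ideal.Quotient.mk _ (b i))
        ?_ ?_ ?_
      · rw [← map_quotientMk_maximalIdeal, ← ha, hra, Ideal.map_span, Set.image_insert_eq,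
          Ideal.Quotient.eq_zero_iff_mem.2 (Ideal.mem_span_singleton_self x),
          Ideal.span_insert_zero, ← Set.range_comp]
        rfl
      · rw [← map_quotientMk_maximalIdeal, ← hb, Ideal.map_span, Set.image_insert_eq,
          Ideal.Quotient.eq_zero_iff_mem.2 (Ideal.mem_span_singleton_self y),
          Ideal.span_insert_zero, Set.image_union, ← Set.range_comp, ← Set.range_comp]
        rfl
      · rw [← ENat.WithBot.add_le_add_one_right_iff]
        refine le_trans ?_ (ringKrullDim_le_quotient_span_singleton_succ hym)
        rw [add_right_comm] at hdim
        exact_mod_cast hdim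
    exact flat_of_flat_quotient_span_singleton (mem_nonZeroDivisors_of_ne_zero hy0)
      (maximalIdeal_le_jacobson _ hym) Ideal.Quotient.mk_surjective Ideal.Quotient.mk_surjective
      Ideal.mk_ker Ideal.mk_ker fun _ ↦ rfl

end

open IsLocalRing in
theorem stmt_2 (A B : Type*) [CommRing A] [CommRing B]
    [IsLocalRing A] [IsLocalRing B] [IsNoetherianRing A] [IsNoetherianRing B]
    [Algebra A B] [IsLocalHom (algebraMap A B)]
    (hdim : ringKrullDim B = ringKrullDim A +
      ringKrullDim (B ⧸ Ideal.map (algebraMap A B) (IsLocalRing.maximalIdeal A)))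
    (hA : IsRegularLocal A)
    (hfib : IsRegularLocal (B ⧸ Ideal.map (algebraMap A B) (IsLocalRing.maximalIdeal A))) :
    Module.Flat A B ∧ IsRegularLocal B := by
  classical
  obtain ⟨-, _, s, hs, hsd⟩ := hA
  obtain ⟨-, _, t, ht, htd⟩ := hfib
  rw [← hsd, ← htd] at hdim
  have hdim' : ((s.card + t.card : ℕ) : WithBot ℕ∞) = ringKrullDim B := by
    rw [hdim]
    exact Nat.cast_add _ _
  let a : Fin s.card → A := fun i ↦ s.equivFin.symm i
  have hra : Set.range a = s := by
    rw [show a = Subtype.val ∘ s.equivFin.symm from rfl, EquivLike.range_comp]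
    exact Subtype.range_coe
  choose b hbt using fun i : t ↦ Ideal.Quotient.mk_surjective i.1
  have ha : Ideal.span (Set.range a) = maximalIdeal A := by rw [hra, hs]
  have hb : Ideal.span (Set.range (algebraMap A B ∘ a) ∪ Set.range b) = maximalIdeal B := by
    rw [Ideal.span_union, Set.range_comp, ← Ideal.map_span, ha, sup_comm,
      ← eq_maximalIdeal (Ideal.comap_isMaximal_of_surjective _ Ideal.Quotient.mk_surjective
        (K := maximalIdeal (B ⧸ (maximalIdeal A).map (algebraMap A B)))), ← ht]
    have : (t : Set (B ⧸ (maximalIdeal A).map (algebraMap A B))) =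
        Ideal.Quotient.mk _ '' Set.range b := by
      rw [← Set.range_comp, show Ideal.Quotient.mk _ ∘ b = Subtype.val from funext hbt]
      exact Subtype.range_coe.symm
    rw [this, ← Ideal.map_span, Ideal.comap_map_of_surjective _ Ideal.Quotient.mk_surjective,
      ← RingHom.ker_eq_comap_bot, Ideal.mk_ker]
  refine ⟨flat_of_span_range_eq s.card a b ha hb ?_, inferInstance, inferInstance,
    Finset.univ.image (Sum.elim (algebraMap A B ∘ a) b), ?_, le_antisymm ?_ ?_⟩
  · simpa using hdim'.le
  · rwa [Finset.coe_image, Finset.coe_univ, Set.image_univ, Set.Sum.elim_range]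
  · rw [← hdim']
    have := Finset.card_image_le (s := Finset.univ) (f := Sum.elim (algebraMap A B ∘ a) b)
    rw [Finset.card_univ, Fintype.card_sum, Fintype.card_fin, Fintype.card_coe] at this
    exact Nat.cast_le (α := WithBot ℕ∞).2 this
  · rw [← Fintype.card_coe]
    refine ringKrullDim_le_card_of_span_range_eq (Subtype.val) ?_
    rwa [Subtype.range_coe_subtype, Finset.setOfPred_mem, Finset.coe_image, Finset.coe_univ,
      Set.image_univ, Set.Sum.elim_range]
end

section
/- Let k be an algebraically closed field of characteristic zero, B = k[Y_1, …, Y_n] a polynomial ring, L a finite Galois extension of the quotient field of B, and D the integral closure of B in L. If D is étale over B, then D = B. -/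
universe u

section

open Polynomial WithZero

theorem Derivation.apply_aeval_eq_sum_add {R K L : Type*} [CommRing R] [CommRing K] [CommRing L]
    [Algebra K L] [Algebra R L] (d : Derivation R L L) (a : L) (p : K[X]) :
    d (aeval a p) =
      (p.sum fun i c => d (algebraMap K L c) * a ^ i) + aeval a (derivative p) * d a := by
  induction p using Polynomial.induction_on' with
  | add p q hp hq =>
    rw [Polynomial.sum_add_index _ _ _ (by simp) (by intros; simp [add_mul])]
    simp only [map_add, hp, hq]
    ring
  | monomial n c =>
    rw [Polynomial.sum_monomial_index _ _ (by simp)]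
    simp [aeval_monomial, derivative_monomial, Derivation.leibniz, Derivation.leibniz_pow]
    ring

section

variable {R K L : Type*} [CommRing R] [Field K] [Field L] [Algebra K L] [Algebra R L]
  {Γ : Type*} [LinearOrderedCommGroupWithZero Γ]

/-- If `d` scales the valuation of `a` by a factor larger than the bound of `d` on `K`, then powers
of `a` are orthogonal over `K` for the valuation. -/
theorem Valuation.forall_coeff_lt_of_derivation_le (w : Valuation L Γ) (d : Derivation R L L)
    (hw : ∀ m : ℕ, m ≠ 0 → w m = 1) {q μ : Γ} (hq : q < μ)
    (hd : ∀ x, w (d x) ≤ μ * w x)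
    (hK : ∀ c : K, w (d (algebraMap K L c)) ≤ q * w (algebraMap K L c))
    {a : L} (ha : a ≠ 0) (hda : w (d a) = μ * w a) (n : ℕ) :
    ∀ (p : K[X]) (M : Γ), p.natDegree ≤ n →
      (∀ i, w (algebraMap K L (p.coeff i)) * w a ^ i ≤ M) → w (aeval a p) < M →
      ∀ i, w (algebraMap K L (p.coeff i)) * w a ^ i < M := by
  have hμ : 0 < μ := zero_le.trans_lt hq
  have hwa : 0 < w a := by simpa [zero_lt_iff] using ha
  induction n with
  | zero =>
    intro p M hp hM hlt i
    rw [eq_C_of_natDegree_le_zero hp] at hlt ⊢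
    rcases i with _ | i
    · simpa using hlt
    · simpa [coeff_C] using zero_le.trans_lt hlt
  | succ n ih =>
    intro p M hp hM hlt
    have hM0 : 0 < M := zero_le.trans_lt hlt
    have h1 : w (aeval a (derivative p) * d a) < μ * M := by
      have h := d.apply_aeval_eq_sum_add a p
      rw [eq_comm, ← eq_sub_iff_add_eq'] at h
      rw [h]
      refine (w.map_sub _ _).trans_lt (max_lt ((hd _).trans_lt ?_) ?_)
      · exact mul_lt_mul_of_pos_left hlt hμ
      · rw [Polynomial.sum_def]
        refine w.map_sum_lt (mul_pos hμ hM0).ne' fun i _ => ?_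
        rw [map_mul, map_pow]
        calc _ ≤ q * w (algebraMap K L (p.coeff i)) * w a ^ i := by gcongr; exact hK _
          _ = q * (w (algebraMap K L (p.coeff i)) * w a ^ i) := mul_assoc _ _ _
          _ ≤ q * M := by gcongr; exact hM i
          _ < μ * M := mul_lt_mul_of_pos_right hq hM0
    have h2 : w (aeval a (derivative p)) < M * (w a)⁻¹ := by
      rw [lt_mul_inv_iff₀ hwa]
      rw [map_mul, hda, mul_left_comm] at h1
      exact lt_of_mul_lt_mul_left h1 hμ.le
    have hc : ∀ i, w (algebraMap K L ((derivative p).coeff i)) * w a ^ i =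
        (w (algebraMap K L (p.coeff (i + 1))) * w a ^ (i + 1)) * (w a)⁻¹ := by
      intro i
      have := hw (i + 1) i.succ_ne_zero
      push_cast at this
      rw [coeff_derivative]
      simp only [map_mul, map_add, map_natCast, map_one, this, mul_one]
      rw [pow_succ, ← mul_assoc, mul_inv_cancel_right₀ hwa.ne']
    have h3 : ∀ i, w (algebraMap K L (p.coeff (i + 1))) * w a ^ (i + 1) < M := by
      intro i
      have := ih (derivative p) (M * (w a)⁻¹) ((natDegree_derivative_le p).trans (by omega))
        (fun i => by rw [hc]; gcongr; exact hM _) h2 i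
      rw [hc] at this
      exact lt_of_mul_lt_mul_right this zero_le
    rintro (_ | i)
    · have h := aeval_eq_sum_range (R := K) (p := p) a
      rw [Finset.sum_range_succ', ← sub_eq_iff_eq_add'] at h
      rw [pow_zero, mul_one]
      have h' : algebraMap K L (p.coeff 0) = p.coeff 0 • a ^ 0 := by simp [Algebra.smul_def]
      rw [h', ← h]
      refine (w.map_sub _ _).trans_lt (max_lt hlt (w.map_sum_lt hM0.ne' fun i _ => ?_))
      simpa [Algebra.smul_def] using h3 i
    · exact h3 i

/-- If a derivation is bounded for a discrete valuation with residue characteristic zero, then on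
an algebraic extension of `K` it satisfies any bound that holds on `K`. -/
theorem Valuation.derivation_le_of_exists_bound [Algebra.IsAlgebraic K L] (w : Valuation L ℤᵐ⁰)
    (d : Derivation R L L) (hw : ∀ m : ℕ, m ≠ 0 → w m = 1) {q C : ℤᵐ⁰}
    (hK : ∀ c : K, w (d (algebraMap K L c)) ≤ q * w (algebraMap K L c))
    (hC : ∀ x, w (d x) ≤ C * w x) (x : L) : w (d x) ≤ q * w x := by
  by_contra! hx
  have hx0 : x ≠ 0 := by rintro rfl; simp at hx
  -- the set of quotients `w (d y) / w y` has a largest element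
  obtain ⟨a, ha, hq, hmax⟩ : ∃ a ≠ 0, q * w a < w (d a) ∧
      ∀ y ≠ 0, w (d y) * (w y)⁻¹ ≤ w (d a) * (w a)⁻¹ := by
    have key : ∀ y, q * w y < w (d y) → w (d y) * (w y)⁻¹ ≠ 0 := fun y hy =>
      mul_ne_zero (zero_le.trans_lt hy).ne' (inv_ne_zero (w.ne_zero_iff.2 (by
        rintro rfl; simp at hy)))
    obtain ⟨z, ⟨a, ha, hqa, haz⟩, hz⟩ := Int.exists_greatest_of_bdd
      (P := fun z => ∃ y ≠ 0, q * w y < w (d y) ∧ w (d y) * (w y)⁻¹ = exp z)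
      ⟨log C, by
        rintro z ⟨y, hy, hqy, hyz⟩
        have hwy : 0 < w y := by simpa [zero_lt_iff] using hy
        have : w (d y) * (w y)⁻¹ ≤ C := (mul_inv_le_iff₀ hwy).2 (hC y)
        rw [hyz] at this
        exact (le_log_iff_exp_le (exp_pos.trans_le this).ne').2 this⟩
      ⟨_, x, hx0, hx, (exp_log (key x hx)).symm⟩
    refine ⟨a, ha, hqa, fun y hy => ?_⟩
    have hwy : 0 < w y := by simpa [zero_lt_iff] using hy
    by_cases hqy : q * w y < w (d y)
    · rw [haz, ← exp_log (key y hqy), exp_le_exp]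
      exact hz _ ⟨y, hy, hqy, (exp_log (key y hqy)).symm⟩
    · have hwa : 0 < w a := by simpa [zero_lt_iff] using ha
      exact ((mul_inv_le_iff₀ hwy).2 (not_lt.1 hqy)).trans ((le_mul_inv_iff₀ hwa).2 hqa.le)
  have hwa : 0 < w a := by simpa [zero_lt_iff] using ha
  set p := minpoly K a
  obtain ⟨i, hi, hmx⟩ := Finset.exists_max_image (Finset.range (p.natDegree + 1))
    (fun i => w (algebraMap K L (p.coeff i)) * w a ^ i) ⟨0, by simp⟩
  have hle : ∀ j, w (algebraMap K L (p.coeff j)) * w a ^ j ≤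
      w (algebraMap K L (p.coeff i)) * w a ^ i := by
    intro j
    by_cases hj : j ≤ p.natDegree
    · exact hmx j (by simp; omega)
    · simp [coeff_eq_zero_of_natDegree_lt (not_le.mp hj)]
  refine (w.forall_coeff_lt_of_derivation_le d hw (q := q) (μ := w (d a) * (w a)⁻¹) ?_ ?_ hK ha
    ?_ _ p _ le_rfl hle ?_ i).false
  · rwa [lt_mul_inv_iff₀ hwa]
  · intro y
    by_cases hy : y = 0
    · simp [hy]
    have hwy : 0 < w y := by simpa [zero_lt_iff] using hy
    rw [← mul_inv_le_iff₀ hwy]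
    exact hmax y hy
  · rw [inv_mul_cancel_right₀ hwa.ne']
  · rw [minpoly.aeval, map_zero]
    refine lt_of_lt_of_le ?_ (hle p.natDegree)
    have := minpoly.monic (Algebra.IsIntegral.isIntegral (R := K) a)
    rw [this.coeff_natDegree]
    simpa using pow_pos hwa _

end

end

section

open WithZero IsDedekindDomain TensorProduct

theorem Derivation.exists_valuation_le_of_finite {k A R L Γ : Type*} [CommRing k] [CommRing A]
    [CommRing R] [CommRing L] [Algebra A R] [Algebra R L] [Algebra A L] [IsScalarTower A R L]
    [Algebra k L] [Module.Finite A R] [LinearOrderedCommGroupWithZero Γ] (w : Valuation L Γ)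
    (d : Derivation k L L) (hR : ∀ x : R, w (algebraMap R L x) ≤ 1) {q : Γ}
    (hA : ∀ c : A, w (d (algebraMap A L c)) ≤ q) :
    ∃ C, ∀ x : R, w (d (algebraMap R L x)) ≤ C := by
  obtain ⟨s, hs⟩ := Module.Finite.fg_top (R := A) (M := R)
  obtain ⟨C, hC⟩ := (((s.image fun x => w (d (algebraMap R L x))) ∪ {q}).finite_toSet).bddAbove
  have hq : q ≤ C := hC (by simp)
  have hsC : ∀ x ∈ s, w (d (algebraMap R L x)) ≤ C := fun x hx => hC (by
    simp only [Finset.coe_union, Finset.coe_image]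
    exact Or.inl ⟨x, hx, rfl⟩)
  refine ⟨C, fun x => ?_⟩
  have hx : x ∈ Submodule.span A (s : Set R) := hs ▸ Submodule.mem_top
  induction hx using Submodule.span_induction with
  | mem x hx => exact hsC x hx
  | zero => simp
  | add x y _ _ hx hy =>
    rw [map_add, map_add]
    exact w.map_add_le hx hy
  | smul c x _ hx =>
    have hc : w (algebraMap A L c) ≤ 1 := by
      rw [IsScalarTower.algebraMap_apply A R L]; exact hR _
    rw [Algebra.smul_def, map_mul, ← IsScalarTower.algebraMap_apply, d.leibniz, smul_eq_mul,
      smul_eq_mul]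
    refine w.map_add_le ?_ ?_
    · rw [map_mul]; exact (mul_le_of_le_one_left' hc).trans hx
    · rw [map_mul]; exact (mul_le_of_le_one_left' (hR x)).trans ((hA c).trans hq)

/-- A derivation bounded on a Dedekind domain is bounded for its adic valuations. -/
theorem IsDedekindDomain.HeightOneSpectrum.exists_valuation_derivation_le {k R L : Type*}
    [CommRing k] [CommRing R] [IsDedekindDomain R] [Field L] [Algebra R L] [IsFractionRing R L]
    [Algebra k L] (P : HeightOneSpectrum R) (d : Derivation k L L) {C : ℤᵐ⁰}
    (hR : ∀ x : R, P.valuation L (d (algebraMap R L x)) ≤ C) :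
    ∃ C', ∀ x, P.valuation L (d x) ≤ C' * P.valuation L x := by
  set w := P.valuation L
  have hunit : ∀ u, w u = 1 → w (d u) ≤ C := by
    intro u hu
    obtain ⟨r, s, h⟩ := P.exists_primeCompl_mul_eq_of_integer u hu.le
    have hs : w (algebraMap R L s) = 1 := by
      rw [P.valuation_of_algebraMap, P.intValuation_eq_one_iff_mem_primeCompl]
      exact s.2
    have h1 := congrArg d h
    rw [d.leibniz, smul_eq_mul, smul_eq_mul, ← eq_sub_iff_add_eq'] at h1
    have h2 := congrArg w h1
    rw [map_mul, hs, one_mul] at h2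
    rw [h2]
    refine w.map_sub_le (hR r) ?_
    rw [map_mul, hu, one_mul]
    exact hR _
  obtain ⟨π, hπ⟩ := P.valuation_exists_uniformizer L
  have hπ0 : π ≠ 0 := by
    rintro rfl; rw [map_zero] at hπ; exact exp_ne_zero hπ.symm
  have hwπ : w π ≠ 0 := w.ne_zero_iff.2 hπ0
  refine ⟨max C (w (d π) * (w π)⁻¹), fun x => ?_⟩
  by_cases hx : x = 0
  · simp [hx]
  have hwx : w x ≠ 0 := w.ne_zero_iff.2 hx
  obtain ⟨m, hm⟩ : ∃ m : ℤ, w π ^ m = w x := by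
    refine ⟨-log (w x), ?_⟩
    change P.valuation L π ^ _ = _
    rw [hπ, ← exp_zsmul, smul_eq_mul, neg_mul_neg, mul_one, exp_log hwx]
  have hu : w (x / π ^ m) = 1 := by
    rw [map_div₀, map_zpow₀, hm, div_self hwx]
  have hxu : x = π ^ m * (x / π ^ m) := (mul_div_cancel₀ _ (zpow_ne_zero _ hπ0)).symm
  set u := x / π ^ m
  have hdint : ∀ m : ℤ, w m ≤ 1 := by
    intro m
    have := P.valuation_le_one (K := L) (m : R)
    simpa using this
  rw [hxu, d.leibniz, d.leibniz_zpow]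
  simp only [smul_eq_mul, zsmul_eq_mul]
  refine w.map_add_le ?_ ?_
  · simp only [map_mul, map_zpow₀, hu, mul_one]
    rw [mul_comm]
    gcongr
    exact (hunit u hu).trans (le_max_left _ _)
  · simp only [map_mul, map_zpow₀, hu, mul_one, one_mul]
    calc _ ≤ 1 * (w π ^ (m - 1) * w (d π)) := by gcongr; exact hdint m
      _ = (w (d π) * (w π)⁻¹) * w π ^ m := by
        rw [one_mul, zpow_sub_one₀ hwπ, mul_comm (_ * _), mul_comm (_ ^ _), mul_assoc]
      _ ≤ _ := by gcongr; exact le_max_right _ _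

/-- A nontrivial discrete valuation on `K` extends to a finite separable extension, and derivations
bounded on `K` are bounded for the extended valuation. -/
theorem Valuation.exists_extension_derivation_bound (k : Type*) {K L : Type*} [CommRing k]
    [Field K] [Field L] [Algebra K L] [Algebra k L] [FiniteDimensional K L]
    [Algebra.IsSeparable K L] (v : Valuation K ℤᵐ⁰) (hv : ∃ c, 1 < v c) :
    ∃ w : Valuation L ℤᵐ⁰, (∀ c : K, v c ≤ 1 → w (algebraMap K L c) ≤ 1) ∧
      (∀ c : K, 1 < v c → 1 < w (algebraMap K L c)) ∧
      ∀ (d : Derivation k L L) (q : ℤᵐ⁰),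
        (∀ c : K, w (d (algebraMap K L c)) ≤ q * w (algebraMap K L c)) →
        ∃ C, ∀ x, w (d x) ≤ C * w x := by
  have hnt : v.IsNontrivial := by
    obtain ⟨c, hc⟩ := hv
    exact ⟨c, (zero_lt_one.trans hc).ne', hc.ne'⟩
  have : Nontrivial (MonoidWithZeroHom.valueGroup (.ofClass v)) := by
    infer_instance
  have : IsCyclic (MonoidWithZeroHom.valueGroup (.ofClass v)) := by
    infer_instance
  let A := v.valuationSubring
  have : IsScalarTower A K L := inferInstance
  have : Module.Finite A (integralClosure A L) := IsIntegralClosure.finite A K L _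
  have : IsDedekindDomain (integralClosure A L) := integralClosure.isDedekindDomain A K L
  have : IsFractionRing (integralClosure A L) L :=
    IsIntegralClosure.isFractionRing_of_finite_extension A K L _
  have hinj : Function.Injective (algebraMap A (integralClosure A L)) := by
    have : Function.Injective (algebraMap A L) := by
      rw [IsScalarTower.algebraMap_eq A K L]
      exact (algebraMap K L).injective.comp (IsFractionRing.injective A K)
    rw [IsScalarTower.algebraMap_eq A (integralClosure A L) L] at this
    rw [RingHom.coe_comp] at this; exact this.of_comp
  obtain ⟨P, hP, hPm⟩ := Ideal.exists_ideal_over_maximal_of_isIntegral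
    (S := integralClosure A L) (IsLocalRing.maximalIdeal A)
    (by rw [(RingHom.injective_iff_ker_eq_bot _).1 hinj]; exact bot_le)
  have hP0 : P ≠ ⊥ := by
    rintro rfl
    rw [← RingHom.ker_eq_comap_bot, (RingHom.injective_iff_ker_eq_bot _).1 hinj] at hPm
    exact IsDiscreteValuationRing.not_a_field A hPm.symm
  let Q : HeightOneSpectrum (integralClosure A L) := ⟨P, hP.isPrime, hP0⟩
  refine ⟨Q.valuation L, ?_, ?_, ?_⟩
  · intro c hc
    exact Q.valuation_le_one (K := L) (algebraMap A _ ⟨c, hc⟩)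
  · intro c hc
    have hc' : v c⁻¹ < 1 := by rw [map_inv₀]; exact inv_lt_one_of_one_lt₀ hc
    have hmem : (⟨c⁻¹, hc'.le⟩ : A) ∈ IsLocalRing.maximalIdeal A := by
      rw [Valuation.mem_maximalIdeal_iff]
      exact hc'
    rw [← hPm] at hmem
    have h := (Q.valuation_lt_one_iff_mem (K := L) _).2 hmem
    have h' : Q.valuation L (algebraMap K L c⁻¹) < 1 := h
    rw [map_inv₀, map_inv₀] at h'
    by_contra! hle
    have h0 : Q.valuation L (algebraMap K L c) ≠ 0 := by
      rw [Valuation.ne_zero_iff, _root_.map_ne_zero]; rintro rfl; simp at hc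
    exact absurd h' (not_lt.2 ((one_le_inv₀ (zero_lt_iff.2 h0)).2 hle))
  · intro d q hq
    obtain ⟨C, hC⟩ := d.exists_valuation_le_of_finite (A := A) (R := integralClosure A L)
      (Q.valuation L) (fun x => Q.valuation_le_one (K := L) x) (q := q) (fun c => by
        refine (hq c).trans (mul_le_of_le_one_right' ?_)
        exact Q.valuation_le_one (K := L) (algebraMap A _ c))
    exact Q.exists_valuation_derivation_le d hC

theorem MvPolynomial.totalDegree_pderiv_lt {σ R : Type*} [CommSemiring R] (i : σ)
    {f : MvPolynomial σ R} (hf : pderiv i f ≠ 0) : (pderiv i f).totalDegree < f.totalDegree := by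
  have h : ∀ m ∈ (pderiv i f).support, (m.sum fun _ e => e) + 1 ≤ f.totalDegree := by
    intro m hm
    rw [mem_support_iff, coeff_pderiv] at hm
    have := le_totalDegree (mem_support_iff.2 (left_ne_zero_of_mul hm))
    rwa [Finsupp.sum_add_index' (by simp) (by simp), Finsupp.sum_single_index rfl] at this
  rw [totalDegree, Finset.sup_lt_iff]
  · exact fun m hm => h m hm
  · obtain ⟨m, hm⟩ := support_nonempty.2 hf
    exact (Nat.succ_pos _).trans_le (h m hm)

open Classical in
/-- The valuation `exp (totalDegree f)` on polynomials, attached to the degree. -/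
noncomputable def MvPolynomial.degreeValuation (σ R : Type*) [CommRing R] [IsDomain R] :
    Valuation (MvPolynomial σ R) ℤᵐ⁰ where
  toFun f := if f = 0 then 0 else exp (f.totalDegree : ℤ)
  map_zero' := by simp
  map_one' := by simp
  map_mul' f g := by
    by_cases hf : f = 0
    · simp [hf]
    by_cases hg : g = 0
    · simp [hg]
    simp [hf, hg, totalDegree_mul_of_isDomain hf hg]
  map_add_le_max' f g := by
    by_cases hf : f = 0
    · simp [hf]
    by_cases hg : g = 0
    · simp [hg]
    by_cases hfg : f + g = 0
    · simp [hfg]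
    simp only [hf, hg, hfg, if_false, le_max_iff, exp_le_exp, Nat.cast_le]
    exact le_max_iff.1 (totalDegree_add f g)

namespace MvPolynomial

variable {σ R : Type*} [CommRing R] [IsDomain R]

theorem degreeValuation_apply {f : MvPolynomial σ R} (hf : f ≠ 0) :
    degreeValuation σ R f = exp (f.totalDegree : ℤ) := by
  classical exact if_neg hf

theorem one_le_degreeValuation {f : MvPolynomial σ R} (hf : f ≠ 0) :
    1 ≤ degreeValuation σ R f := by
  rw [degreeValuation_apply hf, ← exp_zero, exp_le_exp]
  positivity

theorem degreeValuation_pderiv_le (i : σ) (f : MvPolynomial σ R) :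
    degreeValuation σ R (pderiv i f) ≤ exp (-1) * degreeValuation σ R f := by
  by_cases h : pderiv i f = 0
  · simp [h]
  have hf : f ≠ 0 := by rintro rfl; simp at h
  rw [degreeValuation_apply h, degreeValuation_apply hf, ← exp_add, exp_le_exp]
  have := totalDegree_pderiv_lt i h
  omega

variable (σ R) in
/-- The extension of `degreeValuation` to the rational function field. -/
noncomputable def fractionDegreeValuation (K : Type*) [Field K] [Algebra (MvPolynomial σ R) K]
    [IsFractionRing (MvPolynomial σ R) K] : Valuation K ℤᵐ⁰ :=
  (degreeValuation σ R).extendToLocalization (S := nonZeroDivisors (MvPolynomial σ R))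
    (fun f hf => by
      rw [Ideal.mem_primeCompl_iff, Valuation.mem_supp_iff,
        degreeValuation_apply (nonZeroDivisors.ne_zero hf)]
      exact exp_ne_zero) K

variable {K : Type*} [Field K] [Algebra (MvPolynomial σ R) K]
    [IsFractionRing (MvPolynomial σ R) K]

theorem fractionDegreeValuation_algebraMap (f : MvPolynomial σ R) :
    fractionDegreeValuation σ R K (algebraMap _ K f) = degreeValuation σ R f :=
  Valuation.extendToLocalization_apply_map_apply _ _ _ _

theorem exists_derivation_eq_algebraMap {k L : Type*} [CommRing k] [Field L] [Algebra k L]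
    [Algebra K L] [Algebra (MvPolynomial σ R) L] [IsScalarTower (MvPolynomial σ R) K L] (i : σ)
    (d : Derivation k L L)
    (hd : ∀ f : MvPolynomial σ R, d (algebraMap _ L f) = algebraMap _ L (pderiv i f)) (c : K) :
    ∃ c' : K, d (algebraMap K L c) = algebraMap K L c' ∧
      fractionDegreeValuation σ R K c' ≤ exp (-1) * fractionDegreeValuation σ R K c := by
  obtain ⟨f, g, hg, rfl⟩ := IsFractionRing.div_surjective (A := MvPolynomial σ R) c
  set φ := algebraMap (MvPolynomial σ R) K with hφ
  have hg0 : fractionDegreeValuation σ R K (φ g) ≠ 0 := by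
    rw [Valuation.ne_zero_iff]
    simpa [hφ] using nonZeroDivisors.ne_zero hg
  refine ⟨(φ g)⁻¹ ^ 2 * (φ (g * pderiv i f - f * pderiv i g)), ?_, ?_⟩
  · rw [map_div₀, d.leibniz_div]
    simp only [hφ, ← IsScalarTower.algebraMap_apply, hd, map_mul, map_pow, map_inv₀, map_sub,
      smul_eq_mul]
  · have h : degreeValuation σ R (g * pderiv i f - f * pderiv i g) ≤
        exp (-1) * degreeValuation σ R f * degreeValuation σ R g := by
      refine Valuation.map_sub_le _ ?_ ?_
      · rw [map_mul, mul_comm]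
        gcongr
        exact degreeValuation_pderiv_le i f
      · rw [map_mul, mul_comm (exp (-1)), mul_assoc]
        gcongr
        exact degreeValuation_pderiv_le i g
    rw [map_mul, map_pow, map_inv₀, map_div₀]
    simp only [hφ, fractionDegreeValuation_algebraMap] at hg0 ⊢
    calc _ ≤ (degreeValuation σ R g)⁻¹ ^ 2 *
          (exp (-1) * degreeValuation σ R f * degreeValuation σ R g) := by gcongr
      _ = (exp (-1) * degreeValuation σ R f) *
          (degreeValuation σ R g * (degreeValuation σ R g)⁻¹ ^ 2) := by
        rw [mul_comm, mul_assoc]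
      _ = _ := by rw [sq, mul_inv_cancel_left₀ hg0, mul_assoc, div_eq_mul_inv]

end MvPolynomial

theorem Derivation.eq_of_formallyUnramified {k B S M : Type*} [CommRing k] [CommRing B]
    [CommRing S] [Algebra k B] [Algebra k S] [Algebra B S] [IsScalarTower k B S]
    [Algebra.FormallyUnramified B S] [AddCommGroup M] [Module k M] [Module S M]
    [Module B M] [IsScalarTower B S M] {d₁ d₂ : Derivation k S M}
    (h : ∀ b : B, d₁ (algebraMap B S b) = d₂ (algebraMap B S b)) : d₁ = d₂ := by
  let e : Derivation B S M := Derivation.mk'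
    { toFun := fun x => d₁ x - d₂ x
      map_add' := fun x y => by simp only [map_add]; abel
      map_smul' := fun b x => by
        simp only [Algebra.smul_def, Derivation.leibniz, h, RingHom.id_apply]
        rw [add_sub_add_right_eq_sub, ← smul_sub, algebraMap_smul] }
    (fun x y => by
      simp only [LinearMap.coe_mk, AddHom.coe_mk, Derivation.leibniz, smul_sub]
      abel)
  ext x
  have he : e x = 0 := by
    rw [← Derivation.liftKaehlerDifferential_comp_D e x,
      Subsingleton.elim (KaehlerDifferential.D B S x) 0, map_zero]
  exact sub_eq_zero.1 he

theorem Derivation.exists_extension_of_formallyEtale {k B S M : Type*} [CommRing k] [CommRing B]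
    [CommRing S] [Algebra k B] [Algebra k S] [Algebra B S] [IsScalarTower k B S]
    [Algebra.FormallyEtale B S] [AddCommGroup M] [Module k M] [Module S M] [Module B M]
    [IsScalarTower B S M] [IsScalarTower k S M] [IsScalarTower k B M] (d : Derivation k B M) :
    ∃ d' : Derivation k S M, ∀ b, d' (algebraMap B S b) = d b := by
  let f : Ω[S⁄k] →ₗ[S] M := (d.liftKaehlerDifferential.liftBaseChange S) ∘ₗ
    (KaehlerDifferential.tensorKaehlerEquivOfFormallyEtale k B S).symm.toLinearMap
  refine ⟨f.compDer (KaehlerDifferential.D k S), fun b => ?_⟩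
  have : (KaehlerDifferential.tensorKaehlerEquivOfFormallyEtale k B S).symm
      (KaehlerDifferential.D k S (algebraMap B S b)) = 1 ⊗ₜ KaehlerDifferential.D k B b := by
    rw [LinearEquiv.symm_apply_eq]
    simp
  simp [f, this]

namespace MvPolynomial

theorem mem_range_C_of_pderiv_eq_zero {σ R : Type*} [CommRing R] [IsDomain R] [CharZero R]
    {f : MvPolynomial σ R} (hf : ∀ i, pderiv i f = 0) : ∃ c, C c = f := by
  classical
  refine ⟨coeff 0 f, ?_⟩
  ext m
  rw [coeff_C]
  split_ifs with hm
  · rw [hm]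
  obtain ⟨i, hi⟩ := Finsupp.ne_iff.1 (Ne.symm hm)
  have hle : Finsupp.single i 1 ≤ m := by
    rw [Finsupp.single_le_iff]
    exact Nat.one_le_iff_ne_zero.2 hi
  have h := coeff_pderiv (i := i) f (m - Finsupp.single i 1)
  rw [hf, coeff_zero, tsub_add_cancel_of_le hle] at h
  exact ((mul_eq_zero.1 h.symm).resolve_right (Nat.cast_add_one_ne_zero _)).symm

theorem pderiv_pderiv_comm {σ R : Type*} [CommRing R] (i j : σ) (f : MvPolynomial σ R) :
    pderiv i (pderiv j f) = pderiv j (pderiv i f) := by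
  classical
  have : ⁅(pderiv i : Derivation R (MvPolynomial σ R) (MvPolynomial σ R)),
      (pderiv j : Derivation R (MvPolynomial σ R) (MvPolynomial σ R))⁆ = 0 := by
    refine derivation_ext fun l => ?_
    rw [Derivation.commutator_apply, pderiv_X, pderiv_X]
    simp [Pi.single_apply, apply_ite]
  have h := DFunLike.congr_fun this f
  rw [Derivation.commutator_apply] at h
  exact sub_eq_zero.1 h

section

variable {k σ K L : Type*} [Field k] [Field K] [Field L]
  [Algebra (MvPolynomial σ k) K] [IsFractionRing (MvPolynomial σ k) K] [Algebra K L]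
  [Algebra (MvPolynomial σ k) L] [IsScalarTower (MvPolynomial σ k) K L]
  [Algebra k L]

variable (K) in
/-- A polynomial derivative extended to a finite separable extension of the rational function
field strictly lowers a suitable valuation above the degree valuation. -/
theorem exists_valuation_derivation_lt [CharZero k] [FiniteDimensional K L]
    [Algebra.IsSeparable K L] (i : σ)
    (d : Derivation k L L)
    (hd : ∀ f : MvPolynomial σ k, d (algebraMap _ L f) = algebraMap _ L (pderiv i f)) :
    ∃ w : Valuation L ℤᵐ⁰, (∀ f : MvPolynomial σ k, f ≠ 0 → 1 ≤ w (algebraMap _ L f)) ∧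
      ∃ q < 1, ∀ x, w (d x) ≤ q * w x := by
  set v := fractionDegreeValuation σ k K with hv
  have hX : v (algebraMap _ K (X i : MvPolynomial σ k)) = exp 1 := by
    rw [hv, fractionDegreeValuation_algebraMap, degreeValuation_apply (X_ne_zero i),
      totalDegree_X, Nat.cast_one]
  obtain ⟨w, hw1, hwlt, hwd⟩ := Valuation.exists_extension_derivation_bound k (L := L) v
    ⟨_, by rw [hX, ← exp_zero, exp_lt_exp]; exact zero_lt_one⟩
  have hge : ∀ c : K, 1 ≤ v c → 1 ≤ w (algebraMap K L c) := by
    intro c hc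
    have h := hw1 c⁻¹ (by rw [map_inv₀]; exact inv_le_one_of_one_le₀ hc)
    rw [map_inv₀, map_inv₀] at h
    refine (inv_le_one₀ (zero_lt_iff.2 ?_)).1 h
    rw [Valuation.ne_zero_iff, _root_.map_ne_zero]
    rintro rfl
    simp at hc
  have hwB : ∀ f : MvPolynomial σ k, f ≠ 0 → 1 ≤ w (algebraMap _ L f) := by
    intro f hf
    rw [IsScalarTower.algebraMap_apply _ K L]
    refine hge _ ?_
    rw [hv, fractionDegreeValuation_algebraMap]
    exact one_le_degreeValuation hf
  have hwm : ∀ m : ℕ, m ≠ 0 → w m = 1 := by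
    intro m hm
    have h0 : ((m : MvPolynomial σ k)) ≠ 0 := by
      rw [← map_natCast (C : k →+* MvPolynomial σ k), Ne, C_eq_zero]
      exact_mod_cast hm
    refine le_antisymm ?_ (by simpa using hwB m h0)
    have h1 : v (m : K) ≤ 1 := by
      rw [← map_natCast (algebraMap (MvPolynomial σ k) K), hv, fractionDegreeValuation_algebraMap,
        degreeValuation_apply h0, ← map_natCast (C : k →+* MvPolynomial σ k), totalDegree_C]
      simp
    simpa using hw1 _ h1
  set x := algebraMap _ K (X i : MvPolynomial σ k) with hx
  have hwx : 1 < w (algebraMap K L x) := hwlt _ (by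
    rw [hX, ← exp_zero, exp_lt_exp]; exact zero_lt_one)
  have hK : ∀ c : K, w (d (algebraMap K L c)) ≤
      (w (algebraMap K L x))⁻¹ * w (algebraMap K L c) := by
    intro c
    by_cases hc : c = 0
    · simp [hc]
    obtain ⟨c', hc', hle⟩ := exists_derivation_eq_algebraMap i d hd c
    have hvc : 0 < v c := by simpa [zero_lt_iff] using hc
    have h := hw1 (c' * x / c) (by
      rw [map_div₀, map_mul, hX]
      refine div_le_one_of_le₀ ?_ zero_le
      calc _ ≤ exp (-1) * v c * exp 1 := by gcongr
        _ = v c := by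
          rw [mul_comm, ← mul_assoc, ← exp_add]
          simp)
    have hwc : 0 < w (algebraMap K L c) := by simpa [zero_lt_iff] using hc
    rw [map_div₀, map_div₀, map_mul, map_mul, div_le_one₀ hwc] at h
    rw [hc', inv_mul_eq_div, le_div_iff₀ (zero_lt_one.trans hwx)]
    exact h
  obtain ⟨C, hC⟩ := hwd d _ hK
  exact ⟨w, hwB, _, inv_lt_one_of_one_lt₀ hwx, w.derivation_le_of_exists_bound d hwm hK hC⟩

variable [IsScalarTower k (MvPolynomial σ k) L]

variable (K) in
theorem derivation_algEquiv_comm [Algebra.IsSeparable K L] (i : σ) (d : Derivation k L L)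
    (hd : ∀ f : MvPolynomial σ k, d (algebraMap _ L f) = algebraMap _ L (pderiv i f))
    (s : L ≃ₐ[K] L) (x : L) : d (s x) = s (d x) := by
  have hs : ∀ f : MvPolynomial σ k, s (algebraMap _ L f) = algebraMap _ L f := by
    intro f
    rw [IsScalarTower.algebraMap_apply _ K L, s.commutes]
  have hs' : ∀ f : MvPolynomial σ k, s.symm (algebraMap _ L f) = algebraMap _ L f := by
    intro f
    rw [IsScalarTower.algebraMap_apply _ K L, s.symm.commutes]
  let e : Derivation k L L := Derivation.mk'
    { toFun := fun x => s.symm (d (s x))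
      map_add' := fun x y => by simp only [map_add]
      map_smul' := fun c x => by
        simp only [Algebra.smul_def, RingHom.id_apply]
        rw [IsScalarTower.algebraMap_apply k (MvPolynomial σ k) L, map_mul, hs,
          ← IsScalarTower.algebraMap_apply k (MvPolynomial σ k) L, ← Algebra.smul_def, d.map_smul,
          Algebra.smul_def, map_mul, IsScalarTower.algebraMap_apply k (MvPolynomial σ k) L, hs'] }
    (fun x y => by simp [Derivation.leibniz])
  have : Algebra.FormallyUnramified (MvPolynomial σ k) K :=
    .of_isLocalization (nonZeroDivisors (MvPolynomial σ k))
  have : Algebra.FormallyUnramified K L := .of_isSeparable K L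
  have : Algebra.FormallyUnramified (MvPolynomial σ k) L := .comp _ K L
  have h : e = d := Derivation.eq_of_formallyUnramified (B := MvPolynomial σ k) fun f => by
    change s.symm (d (s _)) = _
    rw [hs, hd, hs']
  rw [← DFunLike.congr_fun h x]
  exact (s.apply_symm_apply _).symm

variable [CharZero k]

variable (K) in
/-- An extended partial derivative preserving integrality is locally nilpotent on integral
elements of a Galois extension. -/
theorem exists_iterate_derivation_eq_zero [FiniteDimensional K L] [IsGalois K L] (i : σ)
    (d : Derivation k L L)
    (hd : ∀ f : MvPolynomial σ k, d (algebraMap _ L f) = algebraMap _ L (pderiv i f))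
    (hdint : ∀ x, IsIntegral (MvPolynomial σ k) x → IsIntegral (MvPolynomial σ k) (d x))
    {a : L} (ha : IsIntegral (MvPolynomial σ k) a) : ∃ N, d^[N] a = 0 := by
  classical
  obtain ⟨w, hwB, q, hq, hwq⟩ := exists_valuation_derivation_lt K i d hd
  have hpow : ∀ (N : ℕ) (x : L), w (d^[N] x) ≤ q ^ N * w x := by
    intro N
    induction N with
    | zero => simp
    | succ N ih =>
      intro x
      rw [Function.iterate_succ_apply', pow_succ', mul_assoc]
      exact (hwq _).trans (by gcongr; exact ih x)
  have hcomm : ∀ (N : ℕ) (s : L ≃ₐ[K] L) (x : L), s (d^[N] x) = d^[N] (s x) := fun N s =>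
    Function.Semiconj.iterate_right (fun x => (derivation_algEquiv_comm K i d hd s x).symm) N
  have hintN : ∀ N, IsIntegral (MvPolynomial σ k) (d^[N] a) := by
    intro N
    induction N with
    | zero => exact ha
    | succ N ih => rw [Function.iterate_succ_apply']; exact hdint _ ih
  have hsmall : ∀ x : L, ∃ N, ∀ M ≥ N, w (d^[M] x) < 1 := by
    intro x
    by_cases hq0 : q = 0
    · refine ⟨1, fun M hM => (hpow M x).trans_lt ?_⟩
      rw [hq0, zero_pow (by omega), zero_mul]
      exact zero_lt_one
    have hq0' : 0 < q := zero_lt_iff.2 hq0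
    obtain ⟨N, hN⟩ := MulArchimedean.arch (w x) ((one_lt_inv₀ hq0').2 hq)
    refine ⟨N + 1, fun M hM => (hpow M x).trans_lt ?_⟩
    calc q ^ M * w x ≤ q ^ (N + 1) * q⁻¹ ^ N :=
          mul_le_mul' (pow_le_pow_of_le_one zero_le hq.le hM) hN
      _ = q := by rw [pow_succ', mul_assoc, ← mul_pow, mul_inv_cancel₀ hq0, one_pow, mul_one]
      _ < 1 := hq
  choose N hN using hsmall
  refine ⟨Finset.univ.sup fun s : L ≃ₐ[K] L => N (s a), ?_⟩
  set M := Finset.univ.sup fun s : L ≃ₐ[K] L => N (s a)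
  by_contra hne
  obtain ⟨f, hf⟩ := IsIntegrallyClosed.isIntegral_iff.1 (Algebra.isIntegral_norm K (hintN M))
  have hf' : algebraMap _ L f = ∏ s : L ≃ₐ[K] L, s (d^[M] a) := by
    rw [IsScalarTower.algebraMap_apply _ K L, hf, Algebra.norm_eq_prod_automorphisms]
  have hf0 : f ≠ 0 := by
    rintro rfl
    rw [map_zero, eq_comm, Finset.prod_eq_zero_iff] at hf'
    obtain ⟨s, -, hs⟩ := hf'
    exact hne (by simpa using hs)
  have h1 := hwB f hf0
  rw [hf', map_prod] at h1
  refine h1.not_gt ?_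
  rw [← Finset.prod_erase_mul _ _ (Finset.mem_univ (1 : L ≃ₐ[K] L))]
  have hlt : ∀ s : L ≃ₐ[K] L, w (s (d^[M] a)) < 1 := fun s => by
    rw [hcomm]
    exact hN _ _ (Finset.le_sup (f := fun s : L ≃ₐ[K] L => N (s a)) (Finset.mem_univ s))
  refine lt_of_le_of_lt ?_ (hlt 1)
  exact mul_le_of_le_one_left' (Finset.prod_le_one' fun s _ => (hlt s).le)

open scoped Polynomial in
theorem mem_range_of_derivation_eq_zero [IsAlgClosed k]
    [Module.IsTorsionFree (MvPolynomial σ k) L] (d : σ → Derivation k L L)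
    (hd : ∀ i (f : MvPolynomial σ k), d i (algebraMap _ L f) = algebraMap _ L (pderiv i f))
    {a : L} (ha : IsIntegral (MvPolynomial σ k) a) (hda : ∀ i, d i a = 0) :
    a ∈ (algebraMap (MvPolynomial σ k) L).range := by
  set p := minpoly (MvPolynomial σ k) a
  have hp : p.Monic := minpoly.monic ha
  have hcoeff : ∀ i j, pderiv i (p.coeff j) = 0 := by
    intro i
    let r : (MvPolynomial σ k)[X] :=
      ∑ j ∈ Finset.range p.natDegree, Polynomial.monomial j (pderiv i (p.coeff j))
    have hr : Polynomial.aeval a r = 0 := by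
      have h := (d i).apply_aeval_eq_sum_add a p
      rw [minpoly.aeval, hda, mul_zero, add_zero, map_zero,
        Polynomial.sum_over_range _ (by simp), Finset.sum_range_succ, hp.coeff_natDegree] at h
      simp only [map_one, Derivation.map_one_eq_zero, zero_mul, add_zero, hd] at h
      simpa [r, Polynomial.aeval_monomial] using h.symm
    have hr0 : r = 0 := by
      by_contra h0
      have h1 := minpoly.IsIntegrallyClosed.degree_le_of_ne_zero h0 hr
      refine h1.not_gt ?_
      rw [Polynomial.degree_eq_natDegree hp.ne_zero]
      refine (Polynomial.degree_sum_le _ _).trans_lt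
        ((Finset.sup_lt_iff (WithBot.bot_lt_coe _)).2 ?_)
      intro j hj
      exact (Polynomial.degree_monomial_le _ _).trans_lt (by exact_mod_cast Finset.mem_range.1 hj)
    intro j
    rcases lt_trichotomy j p.natDegree with hj | hj | hj
    · have := congrArg (fun r => Polynomial.coeff r j) hr0
      simpa [r, Polynomial.finsetSum_coeff, Polynomial.coeff_monomial, hj] using this
    · rw [hj, hp.coeff_natDegree, pderiv_one]
    · rw [Polynomial.coeff_eq_zero_of_natDegree_lt hj, map_zero]
  obtain ⟨q, hq⟩ := (Polynomial.lifts_iff_coeff_lifts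
    (f := (C : k →+* MvPolynomial σ k)) p).2 fun j =>
      mem_range_C_of_pderiv_eq_zero fun i => hcoeff i j
  rw [Polynomial.coe_mapRingHom] at hq
  have hqm : q.Monic := by
    rw [← hq] at hp
    exact (Function.Injective.monic_map_iff (C_injective σ k)).2 hp
  have hak : IsIntegral k a := by
    refine ⟨q, hqm, ?_⟩
    have h : Polynomial.aeval a p = 0 := minpoly.aeval _ _
    rw [← hq, Polynomial.aeval_def, Polynomial.eval₂_map] at h
    rw [IsScalarTower.algebraMap_eq k (MvPolynomial σ k) L]
    exact h
  obtain ⟨c, hc⟩ := minpoly.mem_range_of_degree_eq_one k a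
    (IsAlgClosed.degree_eq_one_of_irreducible k (minpoly.irreducible hak))
  exact ⟨C c, by rw [← hc, IsScalarTower.algebraMap_apply k (MvPolynomial σ k) L]; rfl⟩

/-- Integral elements are polynomials when the partial derivatives extend to commuting derivations
that are locally nilpotent on integral elements. -/
theorem mem_range_of_locally_nilpotent [IsAlgClosed k] [Finite σ]
    [Module.IsTorsionFree (MvPolynomial σ k) L] (d : σ → Derivation k L L)
    (hd : ∀ i (f : MvPolynomial σ k), d i (algebraMap _ L f) = algebraMap _ L (pderiv i f))
    (hdint : ∀ i x, IsIntegral (MvPolynomial σ k) x → IsIntegral (MvPolynomial σ k) (d i x))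
    (hcomm : ∀ i j x, d i (d j x) = d j (d i x))
    (hnil : ∀ i x, IsIntegral (MvPolynomial σ k) x → ∃ N, (d i)^[N] x = 0)
    {a : L} (ha : IsIntegral (MvPolynomial σ k) a) :
    a ∈ (algebraMap (MvPolynomial σ k) L).range := by
  classical
  have := Fintype.ofFinite σ
  suffices h : ∀ s : Finset σ, ∀ a : L, IsIntegral (MvPolynomial σ k) a →
      (∀ i ∉ s, d i a = 0) → a ∈ (algebraMap (MvPolynomial σ k) L).range from
    h Finset.univ a ha (by simp)
  intro s
  induction s using Finset.induction_on with
  | empty => exact fun a ha h => mem_range_of_derivation_eq_zero d hd ha (by simpa using h)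
  | insert j s hj ih =>
    intro a ha hs
    obtain ⟨N, hN⟩ := hnil j a ha
    induction N generalizing a with
    | zero =>
      have : a = 0 := hN
      exact this ▸ zero_mem _
    | succ N ihN =>
      set y : L := algebraMap (MvPolynomial σ k) L (X j)
      have hyj : d j y = 1 := by simp [y, hd]
      have hyi : ∀ i ≠ j, d i y = 0 := fun i hi => by
        simp [y, hd, pderiv_X_of_ne hi.symm]
      have hciter : ∀ i, i ≠ j → d i a = 0 → ∀ m, d i ((d j)^[m] a) = 0 := by
        intro i _ hi m
        rw [Function.Semiconj.iterate_right (f := d i) (fun x => hcomm i j x) m a, hi,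
          iterate_map_zero]
      have hcint : ∀ m, IsIntegral (MvPolynomial σ k) ((d j)^[m] a) := by
        intro m
        induction m with
        | zero => exact ha
        | succ m ih => rw [Function.iterate_succ_apply']; exact hdint _ _ ih
      set c := (d j)^[N] a with hc
      have hcj : d j c = 0 := by rw [hc, ← Function.iterate_succ_apply' (d j)]; exact hN
      have hci : ∀ i ∉ insert j s, d i c = 0 := fun i hi =>
        hciter i (by rintro rfl; simp at hi) (hs i hi) N
      have hcB : c ∈ (algebraMap (MvPolynomial σ k) L).range := ih c (hcint N) fun i hi => by
        by_cases hij : i = j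
        · rw [hij, hcj]
        · exact hci i (by simp [hij, hi])
      obtain ⟨f, hf⟩ := hcB
      set t : L := algebraMap (MvPolynomial σ k) L (C ((N.factorial : k)⁻¹) * f * X j ^ N) with ht
      have hCL : ∀ r : k, algebraMap (MvPolynomial σ k) L (C r) = algebraMap k L r := fun r =>
        (IsScalarTower.algebraMap_apply k (MvPolynomial σ k) L r).symm
      have ht' : t = ((N.factorial : k)⁻¹) • (c * y ^ N) := by
        rw [ht, map_mul, map_mul, hCL, hf, map_pow, Algebra.smul_def, mul_assoc]
      have hiter : ∀ m, (d j)^[m] (c * y ^ m) = m.factorial * c := by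
        intro m
        induction m with
        | zero => simp
        | succ m ih =>
          have h1 : d j (c * y ^ (m + 1)) = (m + 1) • (c * y ^ m) := by
            simp [Derivation.leibniz, Derivation.leibniz_pow, hcj, hyj]
            ring
          rw [Function.iterate_succ_apply, h1, iterate_map_nsmul, ih, Nat.factorial_succ]
          simp [mul_assoc, add_mul]
      have hchar : (N.factorial : k) ≠ 0 := by exact_mod_cast N.factorial_ne_zero
      have hat : a - t ∈ (algebraMap (MvPolynomial σ k) L).range := by
        refine ihN (a - t) (ha.sub isIntegral_algebraMap) (fun i hi => ?_) ?_
        · have hij : i ≠ j := by rintro rfl; simp at hi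
          rw [map_sub, hs i hi, ht', (d i).map_smul, Derivation.leibniz, hci i hi,
            Derivation.leibniz_pow, hyi i hij]
          simp
        · have h2 : (d j)^[N] t = c := by
            have hl : ∀ z : L, (d j)^[N] z = ((d j : L →ₗ[k] L) ^ N) z := fun z => by
              rw [Module.End.pow_apply]; rfl
            rw [ht', hl, map_smul, ← hl, hiter, Algebra.smul_def, ← mul_assoc,
              ← map_natCast (algebraMap k L), ← map_mul, inv_mul_cancel₀ hchar, map_one, one_mul]
          rw [iterate_map_sub, h2, ← hc, sub_self]
      have := add_mem hat (⟨_, rfl⟩ : t ∈ (algebraMap (MvPolynomial σ k) L).range)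
      rwa [sub_add_cancel] at this

end

end MvPolynomial

/-- If the integral closure of `B` in `L` is formally étale over `B`, it is stable under every
derivation of `L` extending a derivation of `B`. -/
theorem Derivation.isIntegral_of_formallyEtale_integralClosure {k B L : Type*} [CommRing k]
    [CommRing B] [CommRing L] [Algebra k B] [Algebra k L] [Algebra B L] [IsScalarTower k B L]
    [Algebra.FormallyEtale B (integralClosure B L)] (d₀ : Derivation k B B) (d : Derivation k L L)
    (hd : ∀ b, d (algebraMap B L b) = algebraMap B L (d₀ b)) {x : L} (hx : IsIntegral B x) :
    IsIntegral B (d x) := by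
  obtain ⟨d', hd'⟩ := Derivation.exists_extension_of_formallyEtale (S := integralClosure B L)
    ((Algebra.linearMap B (integralClosure B L)).compDer d₀)
  let e₁ : Derivation k (integralClosure B L) L :=
    (Algebra.linearMap (integralClosure B L) L).compDer d'
  let e₂ : Derivation k (integralClosure B L) L := d.compAlgebraMap (integralClosure B L)
  have h : e₁ = e₂ := Derivation.eq_of_formallyUnramified (B := B) fun b => by
    change algebraMap (integralClosure B L) L (d' _) = d _
    rw [hd']
    exact (hd b).symm
  have hx' := DFunLike.congr_fun h ⟨x, hx⟩
  have : d x = (d' ⟨x, hx⟩ : integralClosure B L) := hx'.symm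
  rw [this]
  exact (d' ⟨x, hx⟩).2

namespace MvPolynomial

/-- Simple connectedness of affine space over an algebraically closed field of characteristic
zero. -/
theorem integralClosure_eq_bot_of_formallyEtale {k σ L : Type*} (K : Type*) [Field k] [CharZero k]
    [IsAlgClosed k] [Finite σ] [Field K] [Field L]
    [Algebra (MvPolynomial σ k) K] [IsFractionRing (MvPolynomial σ k) K] [Algebra K L]
    [Algebra (MvPolynomial σ k) L] [IsScalarTower (MvPolynomial σ k) K L]
    [FiniteDimensional K L] [IsGalois K L]
    [Algebra.FormallyEtale (MvPolynomial σ k) (integralClosure (MvPolynomial σ k) L)] :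
    integralClosure (MvPolynomial σ k) L = ⊥ := by
  let : Algebra k L := ((algebraMap (MvPolynomial σ k) L).comp C).toAlgebra
  have : IsScalarTower k (MvPolynomial σ k) L := .of_algebraMap_eq' rfl
  have : Algebra.FormallyEtale (MvPolynomial σ k) K :=
    .of_isLocalization (nonZeroDivisors (MvPolynomial σ k))
  have : Algebra.FormallyEtale K L := .of_isSeparable K L
  have : Algebra.FormallyEtale (MvPolynomial σ k) L := .comp _ K L
  have hinj : Function.Injective (algebraMap (MvPolynomial σ k) L) := by
    rw [IsScalarTower.algebraMap_eq _ K L]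
    exact (algebraMap K L).injective.comp (IsFractionRing.injective _ K)
  have : Module.IsTorsionFree (MvPolynomial σ k) L :=
    Module.isTorsionFree_iff_algebraMap_injective.2 hinj
  choose d hd using fun i : σ => Derivation.exists_extension_of_formallyEtale (S := L) (M := L)
    ((Algebra.linearMap (MvPolynomial σ k) L).compDer
      (pderiv i : Derivation k (MvPolynomial σ k) (MvPolynomial σ k)))
  replace hd : ∀ i (f : MvPolynomial σ k),
    d i (algebraMap _ L f) = algebraMap _ L (pderiv i f) := hd
  have hdint : ∀ i x, IsIntegral (MvPolynomial σ k) x → IsIntegral (MvPolynomial σ k) (d i x) :=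
    fun i x hx => Derivation.isIntegral_of_formallyEtale_integralClosure (pderiv i) (d i) (hd i) hx
  have hcomm : ∀ i j x, d i (d j x) = d j (d i x) := by
    intro i j x
    have h : ⁅d i, d j⁆ = 0 :=
      Derivation.eq_of_formallyUnramified (B := MvPolynomial σ k) fun f => by
        rw [Derivation.commutator_apply, hd, hd, hd, hd, pderiv_pderiv_comm, sub_self,
          Derivation.zero_apply]
    have h' := DFunLike.congr_fun h x
    rw [Derivation.commutator_apply] at h'
    exact sub_eq_zero.1 h'
  refine eq_bot_iff.2 fun a ha => Algebra.mem_bot.2 ?_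
  exact mem_range_of_locally_nilpotent d hd hdint hcomm
    (fun i x hx => exists_iterate_derivation_eq_zero K i (d i) (hd i) (hdint i) hx) ha

end MvPolynomial

end

theorem stmt_5 (k : Type u) [Field k] [IsAlgClosed k] [CharZero k] (n : ℕ)
    (L : Type u) [Field L]
    [Algebra (FractionRing (MvPolynomial (Fin n) k)) L]
    [FiniteDimensional (FractionRing (MvPolynomial (Fin n) k)) L]
    [IsGalois (FractionRing (MvPolynomial (Fin n) k)) L]
    [Algebra (MvPolynomial (Fin n) k) L]
    [IsScalarTower (MvPolynomial (Fin n) k) (FractionRing (MvPolynomial (Fin n) k)) L]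
    (hetale : Algebra.Etale (MvPolynomial (Fin n) k)
      (integralClosure (MvPolynomial (Fin n) k) L)) :
    integralClosure (MvPolynomial (Fin n) k) L = ⊥ := by
  exact MvPolynomial.integralClosure_eq_bot_of_formallyEtale (FractionRing (MvPolynomial (Fin n) k))
end

section
/- Let A be a Noetherian ring and B an A-algebra of finite type that is flat over A. Then the induced map Spec(B) → Spec(A) is an open map of topological spaces. -/
theorem stmt_6 (A B : Type*) [CommRing A] [CommRing B] [IsNoetherianRing A]
    [Algebra A B] [Algebra.FiniteType A B] [Module.Flat A B] :
    IsOpenMap (PrimeSpectrum.comap (algebraMap A B)) := by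
  have : Algebra.FinitePresentation A B := Algebra.FinitePresentation.of_finiteType.mp inferInstance
  have : Algebra.HasGoingDown A B := Algebra.HasGoingDown.of_flat
  exact PrimeSpectrum.isOpenMap_comap_of_hasGoingDown_of_finitePresentation
end

section
/- Let k be a field, R a finitely generated k-algebra that is an integral domain, and L a finite algebraic field extension of the fraction field K(R). Then the integral closure of R in L is a finite R-module. -/
open scoped nonZeroDivisors

universe u

/-- If an `A`-algebra `L` embeds into an `A`-algebra `N` such that the integral elements of `L` land
in a finite `A`-module, then the integral closure of the Noetherian ring `A` in `L` is finite. -/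
theorem finite_integralClosure_of_forall_mem {A L N : Type*} [CommRing A] [IsNoetherianRing A]
    [CommRing L] [Algebra A L] [AddCommGroup N] [Module A N] (S : Submodule A N)
    [Module.Finite A S] (f : L →ₗ[A] N) (hf : Function.Injective f)
    (hS : ∀ x, IsIntegral A x → f x ∈ S) : Module.Finite A (integralClosure A L) := by
  let g : integralClosure A L →ₗ[A] S :=
    LinearMap.codRestrict S (f.comp (integralClosure A L).val.toLinearMap) fun x => hS _ x.2
  refine Module.Finite.of_injective g fun x y hxy => Subtype.ext (hf ?_)
  exact congrArg Subtype.val hxy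

/-- Finiteness of the integral closure descends along embeddings. -/
theorem finite_integralClosure_of_injective {A L M : Type*} [CommRing A] [IsNoetherianRing A]
    [CommRing L] [Algebra A L] [CommRing M] [Algebra A M] (f : L →ₐ[A] M)
    (hf : Function.Injective f) [Module.Finite A (integralClosure A M)] :
    Module.Finite A (integralClosure A L) :=
  haveI : Module.Finite A (Subalgebra.toSubmodule (integralClosure A M)) :=
    inferInstanceAs (Module.Finite A (integralClosure A M))
  finite_integralClosure_of_forall_mem (Subalgebra.toSubmodule (integralClosure A M))
    f.toLinearMap hf fun _ hx => hx.map f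

/-- A polynomial all of whose coefficients become `p ^ n`-th powers becomes a `p ^ n`-th power after
substituting `X i ^ p ^ n` for `X i`. -/
theorem MvPolynomial.exists_expand_map_eq_pow {k k' σ : Type*} [CommRing k] [CommRing k']
    (p n : ℕ) [ExpChar k' p] (i : k →+* k') (f : MvPolynomial σ k)
    (hf : ∀ m ∈ f.support, ∃ a, i (f.coeff m) = a ^ p ^ n) :
    ∃ g, expand (p ^ n) (map i f) = g ^ p ^ n := by
  choose! a ha using hf
  refine ⟨∑ m ∈ f.support, monomial m (a m), ?_⟩
  conv_lhs => rw [f.as_sum]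
  rw [sum_pow_char_pow]
  simp only [map_sum, map_monomial, expand_monomial, monomial_pow]
  exact Finset.sum_congr rfl fun m hm => by rw [ha m hm]

/-- After a finite injective extension to another normal domain, finitely many polynomials over a
field become `p ^ n`-th powers. -/
theorem MvPolynomial.exists_finite_injective_forall_eq_pow {k : Type u} {σ : Type*} [Field k]
    [Finite σ]
    (p n : ℕ) [ExpChar k p] (T : Finset (MvPolynomial σ k)) :
    ∃ (k' : Type u) (_ : Field k') (φ : MvPolynomial σ k →+* MvPolynomial σ k'),
      φ.Finite ∧ Function.Injective φ ∧ ∀ f ∈ T, ∃ g, φ f = g ^ p ^ n := by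
  classical
  have hq : 0 < p ^ n := pow_pos (expChar_pos k p) n
  let C₀ : Finset k := T.biUnion fun f => f.support.image f.coeff
  let P : Polynomial k := ∏ c ∈ C₀, (Polynomial.X ^ p ^ n - Polynomial.C c)
  let k' := P.SplittingField
  have : ExpChar k' p := expChar_of_injective_algebraMap (algebraMap k k').injective p
  let φ : MvPolynomial σ k →+* MvPolynomial σ k' :=
    (expand (p ^ n) : MvPolynomial σ k' →ₐ[k'] _).toRingHom.comp (map (algebraMap k k'))
  have hroot : ∀ c ∈ C₀, ∃ a : k', algebraMap k k' c = a ^ p ^ n := by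
    intro c hc
    have hs := Polynomial.SplittingField.splits P
    have hP : P.map (algebraMap k k') ≠ 0 := by
      rw [Ne, Polynomial.map_eq_zero]
      exact Finset.prod_ne_zero_iff.mpr fun c _ => Polynomial.X_pow_sub_C_ne_zero hq c
    have hs' := hs.of_dvd hP (Polynomial.map_dvd _ (Finset.dvd_prod_of_mem
      (fun c => (Polynomial.X ^ p ^ n - Polynomial.C c)) hc))
    obtain ⟨a, ha⟩ := hs'.exists_eval_eq_zero (by
      rw [Polynomial.degree_map, Polynomial.degree_X_pow_sub_C hq]
      exact_mod_cast hq.ne')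
    refine ⟨a, ?_⟩
    rw [Polynomial.eval_map_algebraMap, map_sub, map_pow, Polynomial.aeval_X, Polynomial.aeval_C,
      sub_eq_zero] at ha
    exact ha.symm
  refine ⟨k', inferInstance, φ, ?_, ?_, ?_⟩
  · have hC : φ.comp C = C.comp (algebraMap k k') := by
      ext c
      simp [φ]
    have h_int : φ.IsIntegral := by
      intro f
      induction f using MvPolynomial.induction_on with
      | C c =>
        obtain ⟨r, hr, h⟩ := Algebra.IsIntegral.isIntegral (R := k) c
        refine ⟨r.map C, hr.map _, ?_⟩
        rw [Polynomial.eval₂_map, hC, ← Polynomial.hom_eval₂, h, map_zero]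
      | add f g hf hg => exact hf.add _ hg
      | mul_X f i hf =>
        refine hf.mul _ ?_
        refine ⟨Polynomial.X ^ p ^ n - Polynomial.C (X i),
          Polynomial.monic_X_pow_sub_C _ hq.ne', ?_⟩
        simp [φ]
    refine h_int.to_finite (RingHom.FiniteType.of_comp_finiteType (f := C) ?_)
    rw [hC]
    refine RingHom.FiniteType.comp ?_ ?_
    · exact RingHom.finiteType_algebraMap.mpr (inferInstanceAs
        (Algebra.FiniteType k' (MvPolynomial σ k')))
    · exact RingHom.finiteType_algebraMap.mpr inferInstance
  · exact (expand_injective hq).comp (map_injective _ (algebraMap k k').injective)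
  · intro f hf
    exact exists_expand_map_eq_pow p n (algebraMap k k') f fun m hm => hroot _
      (Finset.mem_biUnion.mpr ⟨f, hf, Finset.mem_image_of_mem _ hm⟩)

/-- If `L` embeds over `A` into the fraction field of a normal domain that is finite over `A`, then
the integral closure of `A` in `L` is finite. -/
theorem finite_integralClosure_of_algHom_fractionRing {A B F L : Type*} [CommRing A]
    [IsNoetherianRing A] [CommRing B] [IsIntegrallyClosed B] [Algebra A B]
    [Module.Finite A B] [Field F] [Algebra B F] [IsFractionRing B F] [Algebra A F]
    [IsScalarTower A B F] [CommRing L] [Algebra A L] (f : L →ₐ[A] F)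
    (hf : Function.Injective f) : Module.Finite A (integralClosure A L) := by
  refine finite_integralClosure_of_forall_mem
    (LinearMap.range (IsScalarTower.toAlgHom A B F).toLinearMap) f.toLinearMap hf fun x hx => ?_
  obtain ⟨y, hy⟩ := IsIntegrallyClosed.isIntegral_iff.mp ((hx.map f).tower_top (A := B))
  exact ⟨y, hy⟩

/-- The integral closure of a polynomial ring over a field in a finite purely inseparable extension
of its fraction field is finite. -/
theorem MvPolynomial.finite_integralClosure_of_isPurelyInseparable {k σ : Type*} [Field k]
    [Finite σ] (K P : Type*) [Field K] [Algebra (MvPolynomial σ k) K]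
    [IsFractionRing (MvPolynomial σ k) K] [Field P] [Algebra K P] [Algebra (MvPolynomial σ k) P]
    [IsScalarTower (MvPolynomial σ k) K P] [FiniteDimensional K P] [IsPurelyInseparable K P] :
    Module.Finite (MvPolynomial σ k) (integralClosure (MvPolynomial σ k) P) := by
  classical
  obtain ⟨p, hp⟩ := ExpChar.exists k
  have : ExpChar K p := expChar_of_injective_ringHom
    ((IsFractionRing.injective (MvPolynomial σ k) K).comp (C_injective σ k))
    p (f := (algebraMap (MvPolynomial σ k) K).comp C)
  let e := IsPurelyInseparable.exponent K P
  let b := Module.finBasis K P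
  choose c hc using fun i => IsPurelyInseparable.exponent_def' K (L := P) p (b i)
  choose N D hD hND using fun i => IsFractionRing.div_surjective (A := MvPolynomial σ k) (c i)
  obtain ⟨k', _, φ, hfin, hinj, hpow⟩ := exists_finite_injective_forall_eq_pow p e
    (Finset.univ.image N ∪ Finset.univ.image D)
  obtain ⟨B, _, _, _, φ, hfin, hinj, hpow⟩ : ∃ (B : Type _) (_ : CommRing B) (_ : IsDomain B)
      (_ : IsIntegrallyClosed B) (φ : MvPolynomial σ k →+* B), φ.Finite ∧ Function.Injective φ ∧
      ∀ f ∈ Finset.univ.image N ∪ Finset.univ.image D, ∃ g, φ f = g ^ p ^ e :=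
    ⟨MvPolynomial σ k', inferInstance, inferInstance,
      UniqueFactorizationMonoid.instIsIntegrallyClosed, φ, hfin, hinj, hpow⟩
  algebraize [φ]
  let F := FractionRing B
  have hinjF : Function.Injective (algebraMap (MvPolynomial σ k) F) := by
    rw [IsScalarTower.algebraMap_eq (MvPolynomial σ k) B F]
    exact (IsFractionRing.injective B F).comp hinj
  let : Algebra K F := (IsFractionRing.lift hinjF).toAlgebra
  have : IsScalarTower (MvPolynomial σ k) K F := IsScalarTower.of_algebraMap_eq fun x =>
    (IsFractionRing.lift_algebraMap hinjF x).symm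
  have : ExpChar F p := expChar_of_injective_algebraMap (algebraMap K F).injective p
  have hc' : ∀ i, ∃ r : F, algebraMap K F (c i) = r ^ p ^ e := by
    intro i
    obtain ⟨g, hg⟩ := hpow (N i) (by simp)
    obtain ⟨h, hh⟩ := hpow (D i) (by simp)
    refine ⟨algebraMap B F g / algebraMap B F h, ?_⟩
    rw [← hND, map_div₀, ← IsScalarTower.algebraMap_apply, ← IsScalarTower.algebraMap_apply,
      IsScalarTower.algebraMap_apply _ B F, IsScalarTower.algebraMap_apply _ B F, div_pow,
      ← map_pow, ← map_pow, ← hg, ← hh]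
    rfl
  have hsplit : ∀ s ∈ Set.range b, IsIntegral K s ∧
      ((minpoly K s).map (algebraMap K F)).Splits := by
    rintro _ ⟨i, rfl⟩
    refine ⟨Algebra.IsIntegral.isIntegral _, ?_⟩
    obtain ⟨r, hr⟩ := hc' i
    have hdvd : minpoly K (b i) ∣ Polynomial.X ^ p ^ e - Polynomial.C (c i) :=
      minpoly.dvd _ _ (by simp [hc, e])
    have heq : (Polynomial.X ^ p ^ e - Polynomial.C (c i)).map (algebraMap K F) =
        (Polynomial.X - Polynomial.C r) ^ p ^ e := by
      rw [sub_pow_expChar_pow]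
      simp [hr]
    refine Polynomial.Splits.of_dvd ?_ ?_ (heq ▸ Polynomial.map_dvd (algebraMap K F) hdvd)
    · exact (Polynomial.Splits.X_sub_C r).pow _
    · exact pow_ne_zero _ (Polynomial.X_sub_C_ne_zero r)
  have htop : IntermediateField.adjoin K (Set.range b) = ⊤ := by
    refine top_le_iff.mp fun x _ => ?_
    have hx : x ∈ Submodule.span K (Set.range b) := b.span_eq ▸ Submodule.mem_top
    exact (Submodule.span_le (p := Subalgebra.toSubmodule
      (IntermediateField.adjoin K (Set.range b)).toSubalgebra)).mpr
      (IntermediateField.subset_adjoin K _) hx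
  obtain ⟨f⟩ := IntermediateField.nonempty_algHom_of_adjoin_splits hsplit htop
  exact finite_integralClosure_of_algHom_fractionRing (B := B) (F := F)
    (f.restrictScalars (MvPolynomial σ k)) f.injective

/-- The field fixed by all automorphisms of a normal extension is purely inseparable over the
base field. -/
theorem isPurelyInseparable_fixedField_top (K M : Type*) [Field K] [Field M] [Algebra K M]
    [Normal K M] :
    IsPurelyInseparable K (IntermediateField.fixedField (⊤ : Subgroup Gal(M/K))) := by
  have h_int (x : IntermediateField.fixedField (⊤ : Subgroup Gal(M/K))) : IsIntegral K x :=
    (isIntegral_algHom_iff (IntermediateField.val _) (RingHom.injective _)).mp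
      (Algebra.IsIntegral.isIntegral (R := K) (x : M))
  rw [isPurelyInseparable_iff]
  refine fun x => ⟨h_int x, fun hx => ?_⟩
  by_contra hmem
  have hsep : IsSeparable K (x : M) := by
    rwa [IsSeparable, IntermediateField.minpoly_eq] at hx
  have hbot : (x : M) ∉ (⊥ : Subalgebra K M) := by
    rintro ⟨y, hy⟩
    exact hmem ⟨y, Subtype.ext hy⟩
  obtain ⟨y, hne, hy⟩ := (notMem_iff_exists_ne_and_isConjRoot hsep
    (Normal.splits inferInstance (x : M))).mp hbot
  obtain ⟨s, hs⟩ := hy.symm.exists_algEquiv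
  exact hne ((x.2 ⟨s, Subgroup.mem_top s⟩).symm.trans hs)

/-- If the integral closure of `A` in `P` is finite, then so is the integral closure of `A` in a
finite separable extension of `P`. -/
theorem finite_integralClosure_of_isSeparable (A K P M : Type*) [CommRing A] [IsDomain A]
    [IsNoetherianRing A] [Field K] [Algebra A K] [IsFractionRing A K] [Field P] [Algebra K P]
    [Algebra A P] [IsScalarTower A K P] [FiniteDimensional K P] [Field M] [Algebra P M]
    [Algebra A M] [IsScalarTower A P M] [FiniteDimensional P M] [Algebra.IsSeparable P M]
    [Module.Finite A (integralClosure A P)] : Module.Finite A (integralClosure A M) := by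
  have : IsFractionRing (integralClosure A P) P :=
    integralClosure.isFractionRing_of_finite_extension K P
  have : IsIntegrallyClosed (integralClosure A P) :=
    integralClosure.isIntegrallyClosedOfFiniteExtension K
  have : IsNoetherianRing (integralClosure A P) := IsNoetherianRing.of_finite A _
  have : Module.Finite (integralClosure A P) (integralClosure (integralClosure A P) M) :=
    IsIntegralClosure.finite (integralClosure A P) P M _
  have : Module.Finite A (integralClosure (integralClosure A P) M) :=
    Module.Finite.trans (integralClosure A P) _
  have : Module.Finite A ((Subalgebra.toSubmodule
      (integralClosure (integralClosure A P) M)).restrictScalars A) := this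
  exact finite_integralClosure_of_forall_mem
    ((Subalgebra.toSubmodule (integralClosure (integralClosure A P) M)).restrictScalars A)
    LinearMap.id Function.injective_id fun x hx => hx.tower_top

/-- The integral closure of a polynomial ring over a field in a finite normal extension of its
fraction field is finite. -/
theorem MvPolynomial.finite_integralClosure_of_normal {k σ : Type*} [Field k]
    [Finite σ] (K M : Type*) [Field K] [Algebra (MvPolynomial σ k) K]
    [IsFractionRing (MvPolynomial σ k) K] [Field M] [Algebra K M] [Algebra (MvPolynomial σ k) M]
    [IsScalarTower (MvPolynomial σ k) K M] [FiniteDimensional K M] [Normal K M] :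
    Module.Finite (MvPolynomial σ k) (integralClosure (MvPolynomial σ k) M) := by
  let A := MvPolynomial σ k
  let P := IntermediateField.fixedField (⊤ : Subgroup Gal(M/K))
  have : IsPurelyInseparable K P := isPurelyInseparable_fixedField_top K M
  have : IsGalois P M := IsGalois.of_fixed_field M (⊤ : Subgroup Gal(M/K))
  have : Module.Finite A (integralClosure A P) :=
    finite_integralClosure_of_isPurelyInseparable K P
  have : IsScalarTower A P M := IsScalarTower.of_algebraMap_eq fun x => by
    rw [IsScalarTower.algebraMap_apply A K M, IsScalarTower.algebraMap_apply A K P]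
    rfl
  exact finite_integralClosure_of_isSeparable A K P M

/-- The integral closure of a polynomial ring over a field in a finite extension of its
fraction field is finite. -/
theorem MvPolynomial.finite_integralClosure {k σ : Type*} [Field k]
    [Finite σ] (K L : Type*) [Field K] [Algebra (MvPolynomial σ k) K]
    [IsFractionRing (MvPolynomial σ k) K] [Field L] [Algebra K L] [Algebra (MvPolynomial σ k) L]
    [IsScalarTower (MvPolynomial σ k) K L] [FiniteDimensional K L] :
    Module.Finite (MvPolynomial σ k) (integralClosure (MvPolynomial σ k) L) := by
  let M := IntermediateField.normalClosure K L (AlgebraicClosure L)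
  have : Module.Finite (MvPolynomial σ k) (integralClosure (MvPolynomial σ k) M) :=
    finite_integralClosure_of_normal K M
  let f : L →ₐ[K] M := (IsScalarTower.toAlgHom K L M)
  exact finite_integralClosure_of_injective (f.restrictScalars (MvPolynomial σ k)) f.injective

theorem stmt_11 (k R : Type*) [Field k] [CommRing R] [IsDomain R]
    [Algebra k R] [Algebra.FiniteType k R]
    (L : Type*) [Field L] [Algebra (FractionRing R) L]
    [FiniteDimensional (FractionRing R) L]
    [Algebra R L] [IsScalarTower R (FractionRing R) L] :
    Module.Finite R (integralClosure R L) := by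
  obtain ⟨s, g, hinj, hfin⟩ := exists_finite_inj_algHom_of_fg k R
  let A := MvPolynomial (Fin s) k
  let : Algebra A R := g.toRingHom.toAlgebra
  have : Module.Finite A R := hfin
  have : FaithfulSMul A R := (faithfulSMul_iff_algebraMap_injective A R).mpr hinj
  let : Algebra A L := ((algebraMap R L).comp (algebraMap A R)).toAlgebra
  have : IsScalarTower A R L := IsScalarTower.of_algebraMap_eq fun _ => rfl
  let K := FractionRing A
  let : Algebra K (FractionRing R) := FractionRing.liftAlgebra A (FractionRing R)
  have : IsScalarTower A K (FractionRing R) := FractionRing.isScalarTower_liftAlgebra A _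
  have : Algebra.IsIntegral A R := Algebra.IsIntegral.of_finite A R
  have : IsLocalization (Algebra.algebraMapSubmonoid R A⁰) (FractionRing R) := inferInstance
  have : FiniteDimensional K (FractionRing R) := .of_isLocalization A R A⁰
  let : Algebra K L := ((algebraMap (FractionRing R) L).comp (algebraMap K _)).toAlgebra
  have : IsScalarTower K (FractionRing R) L := IsScalarTower.of_algebraMap_eq fun _ => rfl
  have : FiniteDimensional K L := FiniteDimensional.trans K (FractionRing R) L
  have : IsScalarTower A (FractionRing R) L := IsScalarTower.of_algebraMap_eq fun x => by
    rw [IsScalarTower.algebraMap_apply A R L, IsScalarTower.algebraMap_apply R (FractionRing R) L,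
      ← IsScalarTower.algebraMap_apply A R (FractionRing R)]
  have : IsScalarTower A K L := IsScalarTower.of_algebraMap_eq fun x => by
    rw [IsScalarTower.algebraMap_apply K (FractionRing R) L,
      ← IsScalarTower.algebraMap_apply A K (FractionRing R), ← IsScalarTower.algebraMap_apply]
  have : Module.Finite A (integralClosure A L) := MvPolynomial.finite_integralClosure K L
  let f : integralClosure A L →ₗ[A] integralClosure R L :=
    LinearMap.codRestrict ((Subalgebra.toSubmodule (integralClosure R L)).restrictScalars A)
      (integralClosure A L).val.toLinearMap fun x => x.2.tower_top
  have hf : Function.Surjective f := fun x =>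
    ⟨⟨x, isIntegral_trans (R := A) (A := R) _ x.2⟩, rfl⟩
  have : Module.Finite A (integralClosure R L) := Module.Finite.of_surjective f hf
  exact Module.Finite.of_restrictScalars_finite A R _
end
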